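/- arXiv:2511.22808 — 4 statements merged into one kernel-verified Lean document; each statement's English description precedes it below -/
import Mathlib

section
/- For every integer n with 50 ≤ n ≤ 100, the number of partitions of n with all odd parts distinct and greater than all (unrestricted) even parts is strictly greater than the number of partitions of n with all (unrestricted) even parts greater than all distinct odd parts; that is, p_{eu}^{od}(n) > p_{od}^{eu}(n). -/
def OddDistinctGtEven (M : Multiset ℕ) : Prop :=
  (M.filter (fun x => Odd x)).Nodup ∧
  ∀ o ∈ M, Odd o → ∀ e ∈ M, Even e → e < o

def EvenGtOddDistinct (M : Multiset ℕ) : Prop :=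
  (M.filter (fun x => Odd x)).Nodup ∧
  ∀ e ∈ M, Even e → ∀ o ∈ M, Odd o → o < e

/-- number of partitions of n with odd parts distinct and all greater than even parts -/
noncomputable def peuod (n : ℕ) : ℕ := Nat.card {p : n.Partition // OddDistinctGtEven p.parts}

/-- number of partitions of n with even parts all greater than the distinct odd parts -/
noncomputable def podeu (n : ℕ) : ℕ := Nat.card {p : n.Partition // EvenGtOddDistinct p.parts}

/-- The multisets of positive integers, all at most `k`, with sum `n` and property `P`. -/
def boundedParts (P : Multiset ℕ → Prop) (k n : ℕ) : Set (Multiset ℕ) :=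
  {M | (∀ x ∈ M, 0 < x ∧ x ≤ k) ∧ M.sum = n ∧ P M}

theorem encard_boundedParts_false (k n : ℕ) :
    (boundedParts (fun _ => False) k n).encard = 0 := by
  simp [boundedParts]

theorem encard_boundedParts_zero {P : Multiset ℕ → Prop} (hP : P 0) (n : ℕ) :
    (boundedParts P 0 n).encard = if n = 0 then 1 else 0 := by
  have key : ∀ M : Multiset ℕ, (∀ x ∈ M, 0 < x ∧ x ≤ 0) ↔ M = 0 := fun M =>
    ⟨fun h => Multiset.eq_zero_of_forall_notMem fun x hx => by have := h x hx; omega,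
      by rintro rfl; simp⟩
  split_ifs with hn
  · have : boundedParts P 0 n = {0} := by
      ext M
      simp only [boundedParts, key, Set.mem_ofPred_eq, Set.mem_singleton_iff]
      exact ⟨fun h => h.1, by rintro rfl; simp [hn, hP]⟩
    simp [this]
  · rw [Set.encard_eq_zero, Set.eq_empty_iff_forall_notMem]
    rintro M ⟨h, hs, -⟩
    rw [key] at h
    subst h
    exact hn (by simpa using hs.symm)

/-- Splitting according to whether the largest admissible part occurs. -/
theorem encard_boundedParts_succ {P Q : Multiset ℕ → Prop} {k l : ℕ} (hl : l ≤ k + 1)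
    (h : ∀ M : Multiset ℕ, (∀ x ∈ M, x ≤ k + 1) →
      (P ((k + 1) ::ₘ M) ↔ Q M ∧ ∀ x ∈ M, x ≤ l)) (n : ℕ) :
    (boundedParts P (k + 1) n).encard = (boundedParts P k n).encard +
      if k + 1 ≤ n then (boundedParts Q l (n - (k + 1))).encard else 0 := by
  have hunion : boundedParts P (k + 1) n = boundedParts P k n ∪
      Multiset.cons (k + 1) ''
        (if k + 1 ≤ n then boundedParts Q l (n - (k + 1)) else ∅) := by
    ext M
    constructor
    · rintro ⟨hM, hs, hp⟩
      by_cases hk : k + 1 ∈ M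
      · right
        obtain ⟨M, rfl⟩ := Multiset.exists_cons_of_mem hk
        rw [Multiset.sum_cons] at hs
        have hM' : ∀ x ∈ M, 0 < x ∧ x ≤ k + 1 := fun x hx => hM x (Multiset.mem_cons_of_mem hx)
        obtain ⟨hq, hlM⟩ := (h M fun x hx => (hM' x hx).2).1 hp
        refine ⟨M, ?_, rfl⟩
        rw [if_pos (by omega)]
        exact ⟨fun x hx => ⟨(hM' x hx).1, hlM x hx⟩, by omega, hq⟩
      · left
        refine ⟨fun x hx => ⟨(hM x hx).1, ?_⟩, hs, hp⟩
        have hxk : x ≠ k + 1 := fun e => hk (e ▸ hx)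
        have := (hM x hx).2
        omega
    · rintro (⟨hM, hs, hp⟩ | ⟨M, hM, rfl⟩)
      · exact ⟨fun x hx => ⟨(hM x hx).1, (hM x hx).2.trans k.le_succ⟩, hs, hp⟩
      · split_ifs at hM with hkn
        · obtain ⟨hM, hs, hq⟩ := hM
          have hk : ∀ x ∈ M, x ≤ k + 1 := fun x hx => (hM x hx).2.trans hl
          refine ⟨?_, ?_, (h M hk).2 ⟨hq, fun x hx => (hM x hx).2⟩⟩
          · intro x hx
            rcases Multiset.mem_cons.1 hx with rfl | hx
            · omega
            · exact ⟨(hM x hx).1, hk x hx⟩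
          · rw [Multiset.sum_cons]
            omega
        · exact hM.elim
  have hdisj : Disjoint (boundedParts P k n) (Multiset.cons (k + 1) ''
      (if k + 1 ≤ n then boundedParts Q l (n - (k + 1)) else ∅)) := by
    rw [Set.disjoint_left]
    rintro _ ⟨hM, -⟩ ⟨M, -, rfl⟩
    have := (hM (k + 1) (Multiset.mem_cons_self _ _)).2
    omega
  have hinj : Function.Injective (Multiset.cons (k + 1)) :=
    fun _ _ => (Multiset.cons_inj_right _).1
  rw [hunion, Set.encard_union_eq hdisj, hinj.encard_image]
  split_ifs <;> simp

/-- All parts are odd and distinct. -/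
def OddDistinct (M : Multiset ℕ) : Prop := M.Nodup ∧ ∀ x ∈ M, Odd x

/-- All parts are even. -/
def AllEven (M : Multiset ℕ) : Prop := ∀ x ∈ M, Even x

theorem le_iff_notMem {M : Multiset ℕ} {k : ℕ} (hM : ∀ x ∈ M, x ≤ k + 1) :
    (∀ x ∈ M, x ≤ k) ↔ k + 1 ∉ M := by
  constructor
  · intro h hk
    have := h _ hk
    omega
  · intro h x hx
    have hxk : x ≠ k + 1 := fun e => h (e ▸ hx)
    have := hM x hx
    omega

theorem oddDistinct_cons_of_odd {M : Multiset ℕ} {k : ℕ} (hk : Odd (k + 1))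
    (hM : ∀ x ∈ M, x ≤ k + 1) :
    OddDistinct ((k + 1) ::ₘ M) ↔ OddDistinct M ∧ ∀ x ∈ M, x ≤ k := by
  rw [le_iff_notMem hM]
  simp only [OddDistinct, Multiset.nodup_cons, Multiset.forall_mem_cons]
  tauto

theorem oddDistinct_cons_of_even {M : Multiset ℕ} {k : ℕ} (hk : Even k) :
    ¬ OddDistinct (k ::ₘ M) := fun h =>
  Nat.not_odd_iff_even.2 hk (h.2 _ (Multiset.mem_cons_self _ _))

theorem allEven_cons_of_odd {M : Multiset ℕ} {k : ℕ} (hk : Odd k) :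
    ¬ AllEven (k ::ₘ M) := fun h =>
  Nat.not_even_iff_odd.2 hk (h _ (Multiset.mem_cons_self _ _))

theorem allEven_cons_of_even {M : Multiset ℕ} {k : ℕ} (hk : Even k) :
    AllEven (k ::ₘ M) ↔ AllEven M := by
  simp [AllEven, hk]

theorem oddDistinctGtEven_cons_of_odd {M : Multiset ℕ} {k : ℕ} (hk : Odd (k + 1))
    (hM : ∀ x ∈ M, x ≤ k + 1) :
    OddDistinctGtEven ((k + 1) ::ₘ M) ↔ OddDistinctGtEven M ∧ ∀ x ∈ M, x ≤ k := by
  have hlt : ∀ e ∈ M, Even e → e < k + 1 := fun e he h =>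
    lt_of_le_of_ne (hM e he) fun h' => Nat.not_even_iff_odd.2 hk (h' ▸ h)
  rw [le_iff_notMem hM]
  simp only [OddDistinctGtEven, Multiset.filter_cons_of_pos M hk, Multiset.nodup_cons,
    Multiset.mem_filter, Multiset.forall_mem_cons, hk, Nat.not_even_iff_odd.2 hk, false_imp_iff,
    true_and, and_true, true_imp_iff]
  tauto

theorem oddDistinctGtEven_cons_of_even {M : Multiset ℕ} {k : ℕ} (hk : Even k)
    (hM : ∀ x ∈ M, x ≤ k) : OddDistinctGtEven (k ::ₘ M) ↔ AllEven M := by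
  constructor
  · intro h x hx
    by_contra hodd
    rw [Nat.not_even_iff_odd] at hodd
    have := h.2 x (Multiset.mem_cons_of_mem hx) hodd k (Multiset.mem_cons_self _ _) hk
    have := hM x hx
    omega
  · intro h
    have hodd : ∀ x ∈ k ::ₘ M, ¬ Odd x := fun x hx =>
      Nat.not_odd_iff_even.2 ((allEven_cons_of_even hk).2 h x hx)
    refine ⟨?_, fun o ho ho' => absurd ho' (hodd o ho)⟩
    rw [Multiset.filter_eq_nil.2 hodd]
    exact Multiset.nodup_zero

theorem evenGtOddDistinct_cons_of_odd {M : Multiset ℕ} {k : ℕ} (hk : Odd (k + 1))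
    (hM : ∀ x ∈ M, x ≤ k + 1) :
    EvenGtOddDistinct ((k + 1) ::ₘ M) ↔ OddDistinct M ∧ ∀ x ∈ M, x ≤ k := by
  rw [← oddDistinct_cons_of_odd hk hM]
  constructor
  · rintro ⟨hnd, hlt⟩
    have hodd : ∀ x ∈ (k + 1) ::ₘ M, Odd x := by
      intro x hx
      rcases Multiset.mem_cons.1 hx with rfl | hxM
      · exact hk
      · by_contra heven
        rw [Nat.not_odd_iff_even] at heven
        have := hlt x hx heven (k + 1) (Multiset.mem_cons_self _ _) hk
        have := hM x hxM
        omega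
    rw [Multiset.filter_eq_self.2 hodd] at hnd
    exact ⟨hnd, hodd⟩
  · rintro ⟨hnd, hodd⟩
    exact ⟨hnd.filter _, fun e he he' => absurd (hodd e he) (Nat.not_odd_iff_even.2 he')⟩

theorem evenGtOddDistinct_cons_of_even {M : Multiset ℕ} {k : ℕ} (hk : Even k)
    (hM : ∀ x ∈ M, x ≤ k) : EvenGtOddDistinct (k ::ₘ M) ↔ EvenGtOddDistinct M := by
  have hlt : ∀ o ∈ M, Odd o → o < k := fun o ho h =>
    lt_of_le_of_ne (hM o ho) fun h' => Nat.not_odd_iff_even.2 hk (h' ▸ h)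
  simp only [EvenGtOddDistinct, Multiset.filter_cons_of_neg M (Nat.not_odd_iff_even.2 hk),
    Multiset.forall_mem_cons, hk, Nat.not_odd_iff_even.2 hk, false_imp_iff, true_and,
    true_imp_iff, and_iff_right hlt]

/-- `addShift k x y` is the list `x + q ^ k * y` of coefficients, truncated to the length of `x`. -/
def addShift : ℕ → List ℕ → List ℕ → List ℕ
  | _, [], _ => []
  | k + 1, a :: x, y => a :: addShift k x y
  | 0, a :: x, [] => a :: x
  | 0, a :: x, b :: y => (a + b) :: addShift 0 x y

theorem length_addShift (k : ℕ) (x y : List ℕ) : (addShift k x y).length = x.length := by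
  fun_induction addShift k x y <;> simp_all

theorem getD_addShift (k : ℕ) (x y : List ℕ) (n : ℕ) (hn : n < x.length) :
    (addShift k x y).getD n 0 = x.getD n 0 + if k ≤ n then y.getD (n - k) 0 else 0 := by
  fun_induction addShift k x y generalizing n with
  | case1 => simp at hn
  | case2 y k a x ih => cases n <;> simp_all
  | case3 => simp
  | case4 a x b y ih => cases n <;> simp_all

/-- `geom k x` is the list of coefficients of `x / (1 - q ^ k)` up to `q ^ 100`. -/
def geom (k : ℕ) (x : List ℕ) : List ℕ := (addShift k x)^[100 / k + 1] []

/-- The list `L` holds the values of `c` up to `100`. -/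
def Tabulates (L : List ℕ) (c : ℕ → ℕ∞) : Prop :=
  L.length = 101 ∧ ∀ n ≤ 100, (L.getD n 0 : ℕ∞) = c n

theorem Tabulates.addShift {x y : List ℕ} {c d e : ℕ → ℕ∞} {k : ℕ} (hx : Tabulates x c)
    (hy : Tabulates y d) (he : ∀ n, e n = c n + if k ≤ n then d (n - k) else 0) :
    Tabulates (addShift k x y) e := by
  refine ⟨(length_addShift k x y).trans hx.1, fun n hn => ?_⟩
  rw [getD_addShift k x y n (by have := hx.1; omega), he, Nat.cast_add, hx.2 n hn]
  split_ifs
  · rw [hy.2 _ (by omega)]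
  · simp

theorem Tabulates.geom {x : List ℕ} {c e : ℕ → ℕ∞} {k : ℕ} (hk : 0 < k) (hx : Tabulates x c)
    (he : ∀ n, e n = c n + if k ≤ n then e (n - k) else 0) : Tabulates (geom k x) e := by
  have key : ∀ j n, n ≤ 100 → n < j * k → (((_root_.addShift k x)^[j] []).getD n 0 : ℕ∞) = e n := by
    intro j
    induction j with
    | zero => intro n _ h; omega
    | succ j ih =>
      intro n hn hj
      rw [Function.iterate_succ_apply', getD_addShift _ _ _ _ (by have := hx.1; omega), he,
        Nat.cast_add, hx.2 n hn]
      split_ifs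
      · rw [ih _ (by omega) (by rw [Nat.succ_mul] at hj; omega)]
      · simp
  refine ⟨?_, fun n hn => key _ n hn ?_⟩
  · rw [_root_.geom, Function.iterate_succ_apply', length_addShift, hx.1]
  · have := Nat.lt_mul_div_succ 100 hk
    rw [mul_comm] at this
    omega

/-- Coefficient lists for the partitions into bounded parts of the four kinds: odd and distinct,
even, odd distinct above even, even above odd distinct. -/
structure Tables where
  oddDistinct : List ℕ
  even : List ℕ
  oddGtEven : List ℕ
  evenGtOdd : List ℕ

/-- Raise the bound on the parts from `k` to `k + 2`, for even `k`. -/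
def Tables.step (k : ℕ) (t : Tables) : Tables where
  oddDistinct := addShift (k + 1) t.oddDistinct t.oddDistinct
  even := geom (k + 2) t.even
  oddGtEven := addShift (k + 2) (addShift (k + 1) t.oddGtEven t.oddGtEven) (geom (k + 2) t.even)
  evenGtOdd := geom (k + 2) (addShift (k + 1) t.evenGtOdd t.oddDistinct)

/-- The tables for parts at most `2 * j`. -/
def tables : ℕ → Tables
  | 0 => let L := 1 :: List.replicate 100 0; ⟨L, L, L, L⟩
  | j + 1 => (tables j).step (2 * j)

/-- The lists in `t` count the partitions with parts at most `k`. -/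
structure Tables.Correct (t : Tables) (k : ℕ) : Prop where
  oddDistinct : Tabulates t.oddDistinct fun n => (boundedParts OddDistinct k n).encard
  even : Tabulates t.even fun n => (boundedParts AllEven k n).encard
  oddGtEven : Tabulates t.oddGtEven fun n => (boundedParts OddDistinctGtEven k n).encard
  evenGtOdd : Tabulates t.evenGtOdd fun n => (boundedParts EvenGtOddDistinct k n).encard

theorem tabulates_boundedParts_zero {P : Multiset ℕ → Prop} (hP : P 0) :
    Tabulates (1 :: List.replicate 100 0) fun n => (boundedParts P 0 n).encard := by
  refine ⟨by simp, fun n hn => ?_⟩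
  simp only [encard_boundedParts_zero hP]
  rcases n with _ | n
  · simp
  · rw [List.getD_cons_succ, List.getD_replicate _ (by omega)]
    simp

theorem encard_boundedParts_succ_of_not {P : Multiset ℕ → Prop} {k : ℕ}
    (h : ∀ M, ¬ P ((k + 1) ::ₘ M)) (n : ℕ) :
    (boundedParts P (k + 1) n).encard = (boundedParts P k n).encard := by
  rw [encard_boundedParts_succ (Q := fun _ => False) le_rfl fun M _ => by simp [h M]]
  simp [encard_boundedParts_false]

theorem Tables.Correct.step {t : Tables} {k : ℕ} (hk : Even k) (ht : t.Correct k) :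
    (t.step k).Correct (k + 2) := by
  have h1 : Odd (k + 1) := hk.add_one
  have h2 : Even (k + 1 + 1) := h1.add_one
  have hE : ∀ n, (boundedParts AllEven (k + 1) n).encard = (boundedParts AllEven k n).encard :=
    encard_boundedParts_succ_of_not fun M => allEven_cons_of_odd h1
  have hD : ∀ n, (boundedParts OddDistinct (k + 2) n).encard =
      (boundedParts OddDistinct (k + 1) n).encard :=
    encard_boundedParts_succ_of_not fun M => oddDistinct_cons_of_even h2
  have even : Tabulates (_root_.geom (k + 2) t.even)
      fun n => (boundedParts AllEven (k + 2) n).encard :=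
    ht.even.geom (by omega) fun n => by
      rw [← hE]
      exact encard_boundedParts_succ le_rfl
        (fun M hM => by rw [allEven_cons_of_even h2]; exact (and_iff_left hM).symm) n
  constructor
  · exact ht.oddDistinct.addShift ht.oddDistinct fun n => by
      rw [hD]
      exact encard_boundedParts_succ k.le_succ (fun M hM => oddDistinct_cons_of_odd h1 hM) n
  · exact even
  · refine Tabulates.addShift (ht.oddGtEven.addShift ht.oddGtEven
      (encard_boundedParts_succ k.le_succ fun M hM => oddDistinctGtEven_cons_of_odd h1 hM)) even
      (encard_boundedParts_succ le_rfl fun M hM => ?_)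
    rw [oddDistinctGtEven_cons_of_even h2 hM]
    exact (and_iff_left hM).symm
  · refine Tabulates.geom (by omega) (ht.evenGtOdd.addShift ht.oddDistinct
      (encard_boundedParts_succ k.le_succ fun M hM => evenGtOddDistinct_cons_of_odd h1 hM))
      (encard_boundedParts_succ le_rfl fun M hM => ?_)
    rw [evenGtOddDistinct_cons_of_even h2 hM]
    exact (and_iff_left hM).symm

theorem correct_tables (j : ℕ) : (tables j).Correct (2 * j) := by
  induction j with
  | zero =>
    constructor <;> refine tabulates_boundedParts_zero ?_
    · simp [OddDistinct]
    · simp [AllEven]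
    · simp [OddDistinctGtEven]
    · simp [EvenGtOddDistinct]
  | succ j ih => exact ih.step (even_two_mul j)

theorem card_partition_eq {P : Multiset ℕ → Prop} {L : List ℕ}
    (hL : Tabulates L fun n => (boundedParts P 100 n).encard) {n : ℕ} (hn : n ≤ 100) :
    Nat.card {p : n.Partition // P p.parts} = L.getD n 0 := by
  have himage : boundedParts P 100 n = Nat.Partition.parts '' {p : n.Partition | P p.parts} := by
    ext M
    constructor
    · rintro ⟨hM, hs, hp⟩
      exact ⟨⟨M, fun hx => (hM _ hx).1, hs⟩, hp, rfl⟩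
    · rintro ⟨p, hp, rfl⟩
      exact ⟨fun x hx => ⟨p.parts_pos hx, (p.le_of_mem_parts hx).trans hn⟩, p.parts_sum, hp⟩
  have hcard := hL.2 n hn
  have hinj : Function.Injective (Nat.Partition.parts (n := n)) := fun _ _ => Nat.Partition.ext
  simp only [himage, hinj.encard_image] at hcard
  change Nat.card ({p : n.Partition | P p.parts} : Set _) = _
  rw [Nat.card_coe_set_eq, Set.ncard, ← hcard, ENat.toNat_natCast]

theorem tables_fifty_lt : ∀ n ≤ 100, 50 ≤ n →
    (tables 50).evenGtOdd.getD n 0 < (tables 50).oddGtEven.getD n 0 := by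
  decide +kernel

theorem peuod_gt_podeu_fifty_to_hundred :
    ∀ n : ℕ, 50 ≤ n → n ≤ 100 → podeu n < peuod n := by
  intro n h50 h100
  have h := correct_tables 50
  rw [podeu, peuod, card_partition_eq h.evenGtOdd h100, card_partition_eq h.oddGtEven h100]
  exact tables_fifty_lt n h100 h50
end

section
/- For each n ∈ {3, 5, 7, 9, 11, 13, 15, 17}, p_{od}^{eu}(n) > p_{eu}^{od}(n); in particular the inequality p_{eu}^{od}(n) > p_{od}^{eu}(n) fails for these values. -/
/-- The weakly decreasing lists of positive integers that are at most `k` and sum to `n`,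
provided `n ≤ fuel`. -/
def descendingLists : ℕ → ℕ → ℕ → List (List ℕ)
  | _, _, 0 => [[]]
  | 0, _, _ + 1 => []
  | fuel + 1, k, n + 1 =>
    (List.range (min k (n + 1))).flatMap fun i =>
      (descendingLists fuel (i + 1) (n - i)).map (List.cons (i + 1))

theorem mem_descendingLists {fuel k n : ℕ} (h : n ≤ fuel) (l : List ℕ) :
    l ∈ descendingLists fuel k n ↔
      l.sum = n ∧ l.Pairwise (· ≥ ·) ∧ ∀ x ∈ l, 0 < x ∧ x ≤ k := by
  induction fuel generalizing k n l with
  | zero =>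
    obtain rfl : n = 0 := by omega
    rcases l with _ | ⟨a, l⟩
    · simp [descendingLists]
    · simp only [descendingLists, List.mem_singleton, List.sum_cons, List.forall_mem_cons]
      constructor
      · simp
      · rintro ⟨h1, -, h2, -⟩
        omega
  | succ fuel ih =>
    rcases n with _ | n
    · rcases l with _ | ⟨a, l⟩
      · simp [descendingLists]
      · simp only [descendingLists, List.mem_singleton, List.sum_cons, List.forall_mem_cons]
        constructor
        · simp
        · rintro ⟨h1, -, h2, -⟩
          omega
    · simp only [descendingLists, List.mem_flatMap, List.mem_range, List.mem_map]
      constructor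
      · rintro ⟨i, hi, t, ht, rfl⟩
        obtain ⟨hs, hp, hb⟩ := (ih (by omega) t).1 ht
        refine ⟨?_, List.pairwise_cons.2 ⟨fun x hx => (hb x hx).2, hp⟩, ?_⟩
        · rw [List.sum_cons]
          omega
        · rw [List.forall_mem_cons]
          refine ⟨by omega, fun x hx => ?_⟩
          have := hb x hx
          omega
      · rintro ⟨hs, hp, hb⟩
        rcases l with _ | ⟨a, t⟩
        · simp at hs
        · rw [List.sum_cons] at hs
          rw [List.pairwise_cons] at hp
          rw [List.forall_mem_cons] at hb
          refine ⟨a - 1, by omega, t, (ih (by omega) t).2 ⟨by omega, hp.2, fun x hx => ?_⟩, ?_⟩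
          · have h1 := hp.1 x hx
            have h2 := hb.2 x hx
            omega
          · congr 1
            omega

theorem nodup_descendingLists (fuel k n : ℕ) : (descendingLists fuel k n).Nodup := by
  induction fuel generalizing k n with
  | zero => cases n <;> simp [descendingLists]
  | succ fuel ih =>
    rcases n with _ | n
    · simp [descendingLists]
    · rw [descendingLists, List.nodup_flatMap]
      refine ⟨fun i _ => (ih _ _).map List.cons_injective, ?_⟩
      refine List.nodup_range.imp fun {i j} hij l hi hj => hij ?_
      obtain ⟨s, -, rfl⟩ := List.mem_map.1 hi
      obtain ⟨t, -, ht⟩ := List.mem_map.1 hj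
      have := (List.cons.inj ht).1
      omega

theorem card_partition_eq_length_filter (P : Multiset ℕ → Prop) [DecidablePred P] (n : ℕ) :
    Nat.card {p : n.Partition // P p.parts} =
      ((descendingLists n n n).filter fun l : List ℕ => P (l : Multiset ℕ)).length := by
  have mem_filter (l : List ℕ) :
      l ∈ ((descendingLists n n n).filter fun l : List ℕ => P (l : Multiset ℕ)).toFinset ↔
        (l.sum = n ∧ l.Pairwise (· ≥ ·) ∧ ∀ x ∈ l, 0 < x ∧ x ≤ n) ∧ P (l : Multiset ℕ) := by
    simp only [List.mem_toFinset, List.mem_filter, mem_descendingLists le_rfl, decide_eq_true_eq]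
  rw [← List.toFinset_card_of_nodup ((nodup_descendingLists n n n).filter _),
    ← Nat.card_eq_finsetCard]
  refine Nat.card_congr
    { toFun := fun p => ⟨p.1.parts.sort (· ≥ ·), (mem_filter _).2 ⟨⟨?_, ?_, fun x hx => ?_⟩, ?_⟩⟩
      invFun := fun l => ⟨⟨(l.1 : Multiset ℕ), fun {x} hx => ?_, ?_⟩, ?_⟩
      left_inv := fun p => Subtype.ext (Nat.Partition.ext (Multiset.sort_eq _ _))
      right_inv := fun l => Subtype.ext ?_ }
  · rw [← Multiset.sum_coe, Multiset.sort_eq, p.1.parts_sum]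
  · exact Multiset.pairwise_sort _ _
  · rw [Multiset.mem_sort] at hx
    exact ⟨p.1.parts_pos hx, p.1.parts_sum ▸ Multiset.le_sum_of_mem hx⟩
  · rw [Multiset.sort_eq]
    exact p.2
  · exact (((mem_filter _).1 l.2).1.2.2 x hx).1
  · rw [Multiset.sum_coe]
    exact ((mem_filter _).1 l.2).1.1
  · exact ((mem_filter _).1 l.2).2
  · exact List.mergeSort_eq_self _ ((mem_filter _).1 l.2).1.2.1

instance : DecidablePred OddDistinctGtEven := fun M => by
  unfold OddDistinctGtEven; infer_instance

instance : DecidablePred EvenGtOddDistinct := fun M => by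
  unfold EvenGtOddDistinct; infer_instance

theorem podeu_gt_peuod_small :
    ∀ n ∈ ({3, 5, 7, 9, 11, 13, 15, 17} : Finset ℕ),
      peuod n < podeu n ∧ ¬ podeu n < peuod n := by
  suffices h : ∀ n ∈ ({3, 5, 7, 9, 11, 13, 15, 17} : Finset ℕ), peuod n < podeu n from
    fun n hn => ⟨h n hn, (h n hn).not_gt⟩
  simp only [peuod, podeu, card_partition_eq_length_filter]
  decide +kernel
end

section
/- For n ≥ 373, p_{od}^{eu}(n) < p_{eu}^{od}(n). -/
/-- The partitions of `N`, as multisets of positive integers. -/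
def partitionMultisets (N : ℕ) : Finset (Multiset ℕ) :=
  (Finset.univ : Finset N.Partition).map ⟨Nat.Partition.parts, fun _ _ h => Nat.Partition.ext h⟩

lemma mem_partitionMultisets {N : ℕ} {l : Multiset ℕ} :
    l ∈ partitionMultisets N ↔ (∀ i ∈ l, 0 < i) ∧ l.sum = N := by
  simp only [partitionMultisets, Finset.mem_map, Finset.mem_univ, true_and]
  constructor
  · rintro ⟨p, rfl⟩
    exact ⟨fun i hi => p.parts_pos hi, p.parts_sum⟩
  · rintro ⟨h1, h2⟩
    exact ⟨⟨l, fun {i} hi => h1 i hi, h2⟩, rfl⟩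

lemma natCard_partition_subtype (n : ℕ) (P : Multiset ℕ → Prop) [DecidablePred P] :
    Nat.card {p : n.Partition // P p.parts} = ((partitionMultisets n).filter P).card := by
  rw [Nat.card_eq_fintype_card, Fintype.card_subtype, partitionMultisets, Finset.filter_map,
    Finset.card_map]
  rfl

lemma sup_mem_of_ne_zero {l : Multiset ℕ} (h : l ≠ 0) : l.sup ∈ l := by
  induction l using Multiset.induction_on with
  | empty => exact absurd rfl h
  | cons a l ih =>
    rw [Multiset.sup_cons]
    rcases le_total l.sup a with h1 | h1
    · simp [sup_eq_left.2 h1]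
    · rw [sup_eq_right.2 h1]
      by_cases hl : l = 0
      · subst hl
        have : a = 0 := by simpa using h1
        simp [this]
      · exact Multiset.mem_cons_of_mem (ih hl)

lemma sup_add_sum_erase_sup (l : Multiset ℕ) : l.sup + (l.erase l.sup).sum = l.sum := by
  by_cases h : l = 0
  · simp [h]
  · exact Multiset.sum_erase (sup_mem_of_ne_zero h)

/-- Double all parts of `l` and add `1, 3, …, 2 * s - 1` to the `s` largest ones
(after padding by zeros). -/
def raise : ℕ → Multiset ℕ → Multiset ℕ
  | 0, l => l.map (2 * ·)
  | s + 1, l => (2 * l.sup + 2 * s + 1) ::ₘ raise s (l.erase l.sup)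

lemma sup_erase_le (l : Multiset ℕ) (a : ℕ) : (l.erase a).sup ≤ l.sup :=
  Multiset.sup_mono (Multiset.erase_subset _ _)

lemma raise_sum (s : ℕ) (l : Multiset ℕ) : (raise s l).sum = s ^ 2 + 2 * l.sum := by
  induction s generalizing l with
  | zero =>
    have := Multiset.sum_map_mul_left (s := l) (a := 2) (f := id)
    simpa [raise] using this
  | succ s ih =>
    rw [raise, Multiset.sum_cons, ih, ← sup_add_sum_erase_sup l]
    ring

lemma le_of_mem_raise {s : ℕ} {l : Multiset ℕ} {x : ℕ} (hx : x ∈ raise s l) :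
    x ≤ 2 * l.sup + 2 * s := by
  induction s generalizing l with
  | zero =>
    simp only [raise, Multiset.mem_map] at hx
    obtain ⟨a, ha, rfl⟩ := hx
    have := Multiset.le_sup ha
    omega
  | succ s ih =>
    rw [raise, Multiset.mem_cons] at hx
    rcases hx with rfl | hx
    · omega
    · have := ih hx
      have := sup_erase_le l l.sup
      omega

lemma even_le_of_mem_raise {s : ℕ} {l : Multiset ℕ} {x : ℕ} (hx : x ∈ raise s l) (he : Even x) :
    x ≤ 2 * l.sup := by
  induction s generalizing l with
  | zero => simpa using le_of_mem_raise hx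
  | succ s ih =>
    rw [raise, Multiset.mem_cons] at hx
    rcases hx with rfl | hx
    · rw [Nat.even_iff] at he
      omega
    · have := ih hx
      have := sup_erase_le l l.sup
      omega

lemma pos_of_mem_raise {s : ℕ} {l : Multiset ℕ} (hl : ∀ i ∈ l, 0 < i) {x : ℕ}
    (hx : x ∈ raise s l) : 0 < x := by
  induction s generalizing l with
  | zero =>
    simp only [raise, Multiset.mem_map] at hx
    obtain ⟨a, ha, rfl⟩ := hx
    have := hl a ha
    omega
  | succ s ih =>
    rw [raise, Multiset.mem_cons] at hx
    rcases hx with rfl | hx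
    · omega
    · exact ih (fun i hi => hl i (Multiset.mem_of_mem_erase hi)) hx

lemma card_odd_raise (s : ℕ) (l : Multiset ℕ) :
    ((raise s l).filter (fun x => Odd x)).card = s := by
  induction s generalizing l with
  | zero =>
    simp only [raise, Multiset.card_eq_zero, Multiset.filter_eq_nil, Multiset.mem_map]
    rintro _ ⟨b, -, rfl⟩
    simp
  | succ s ih =>
    have : Odd (2 * l.sup + 2 * s + 1) := ⟨l.sup + s, by ring⟩
    rw [raise, Multiset.filter_cons_of_pos _ this, Multiset.card_cons, ih]

lemma oddDistinctGtEven_raise (s : ℕ) (l : Multiset ℕ) : OddDistinctGtEven (raise s l) := by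
  induction s generalizing l with
  | zero =>
    have h : ∀ x ∈ raise 0 l, ¬ Odd x := by
      simp only [raise, Multiset.mem_map]
      rintro _ ⟨b, -, rfl⟩
      simp
    refine ⟨?_, fun o ho h' => absurd h' (h o ho)⟩
    rw [Multiset.filter_eq_nil.2 h]
    exact Multiset.nodup_zero
  | succ s ih =>
    have hodd : Odd (2 * l.sup + 2 * s + 1) := ⟨l.sup + s, by ring⟩
    have hsup := sup_erase_le l l.sup
    obtain ⟨h1, h2⟩ := ih (l.erase l.sup)
    refine ⟨?_, ?_⟩
    · rw [raise, Multiset.filter_cons_of_pos _ hodd, Multiset.nodup_cons]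
      refine ⟨fun hm => ?_, h1⟩
      have := le_of_mem_raise (Multiset.mem_filter.1 hm).1
      omega
    · intro o ho hoo e he hee
      rw [raise, Multiset.mem_cons] at ho he
      rcases he with rfl | he
      · exact absurd hodd (Nat.not_odd_iff_even.2 hee)
      rcases ho with rfl | ho
      · have := even_le_of_mem_raise he hee
        omega
      · exact h2 o ho hoo e he hee

lemma raise_injective (s : ℕ) {l m : Multiset ℕ} (hl : ∀ i ∈ l, 0 < i) (hm : ∀ i ∈ m, 0 < i)
    (h : raise s l = raise s m) : l = m := by
  induction s generalizing l m with
  | zero => exact Multiset.map_injective (fun a b hab => by simpa using hab) h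
  | succ s ih =>
    have key : ∀ {l m : Multiset ℕ}, raise (s + 1) l = raise (s + 1) m → l.sup ≤ m.sup := by
      intro l m h
      have : 2 * l.sup + 2 * s + 1 ∈ raise (s + 1) m := by
        rw [← h, raise]
        exact Multiset.mem_cons_self _ _
      have := le_of_mem_raise this
      omega
    have hs : l.sup = m.sup := le_antisymm (key h) (key h.symm)
    rw [raise, raise, hs, Multiset.cons_inj_right, ← hs] at h
    have he := ih (fun i hi => hl i (Multiset.mem_of_mem_erase hi))
      (fun i hi => hm i (Multiset.mem_of_mem_erase hi)) (hs ▸ h)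
    have hz : ∀ {l : Multiset ℕ}, (∀ i ∈ l, 0 < i) → l.sup = 0 → l = 0 := by
      intro l hl h0
      by_contra hne
      have := hl _ (sup_mem_of_ne_zero hne)
      omega
    by_cases h0 : l = 0
    · rw [h0, hz hm (by rw [← hs, h0]; simp)]
    · have h0' : m ≠ 0 := by
        rintro rfl
        exact h0 (hz hl (by rw [hs]; simp))
      rw [← Multiset.cons_erase (sup_mem_of_ne_zero h0),
        ← Multiset.cons_erase (sup_mem_of_ne_zero h0'), hs, ← he]

/-- The number of partitions of `(n - s ^ 2) / 2`, when this is a natural number. -/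
def shiftedCount (n s : ℕ) : ℕ :=
  if s ^ 2 ≤ n ∧ n % 2 = s % 2 then (partitionMultisets ((n - s ^ 2) / 2)).card else 0

lemma sum_shiftedCount_le_peuod (n : ℕ) :
    ∑ s ∈ Finset.range (n + 1), shiftedCount n s ≤ peuod n := by
  classical
  rw [peuod, natCard_partition_subtype]
  simp only [shiftedCount]
  rw [← Finset.sum_filter]
  have hcard : ∀ s ∈ (Finset.range (n + 1)).filter (fun s => s ^ 2 ≤ n ∧ n % 2 = s % 2),
      (partitionMultisets ((n - s ^ 2) / 2)).card =
        ((partitionMultisets ((n - s ^ 2) / 2)).image (raise s)).card := by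
    intro s _
    refine (Finset.card_image_of_injOn fun l hl m hm h => ?_).symm
    exact raise_injective s (mem_partitionMultisets.1 hl).1 (mem_partitionMultisets.1 hm).1 h
  rw [Finset.sum_congr rfl hcard, ← Finset.card_biUnion]
  · refine Finset.card_le_card fun x hx => ?_
    simp only [Finset.mem_biUnion, Finset.mem_filter, Finset.mem_image] at hx
    obtain ⟨s, ⟨-, hs, hpar⟩, l, hl, rfl⟩ := hx
    rw [mem_partitionMultisets] at hl
    rw [Finset.mem_filter, mem_partitionMultisets]
    refine ⟨⟨fun i hi => pos_of_mem_raise hl.1 hi, ?_⟩, oddDistinctGtEven_raise s l⟩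
    have hsq : s ^ 2 % 2 = s % 2 := by
      rcases Nat.mod_two_eq_zero_or_one s with h | h <;> simp [Nat.pow_mod, h]
    rw [raise_sum, hl.2]
    omega
  · intro s _ t _ hst
    rw [Function.onFun, Finset.disjoint_left]
    intro x hx hy
    obtain ⟨l, -, rfl⟩ := Finset.mem_image.1 hx
    obtain ⟨m, -, hm⟩ := Finset.mem_image.1 hy
    apply hst
    rw [← card_odd_raise s l, ← hm, card_odd_raise]

/-- For a finite set `S`, the multiset recording, for each non-element `i` of `S` below its
maximum, the number of elements of `S` above `i`. -/
def inversions (S : Finset ℕ) : Multiset ℕ :=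
  ((Finset.range (S.sup id)) \ S).val.map (fun i => (S.filter (fun a => i < a)).card)

lemma finset_sup_mem {S : Finset ℕ} (h : S.Nonempty) : S.sup id ∈ S := by
  obtain ⟨a, ha, h'⟩ := Finset.exists_mem_eq_sup S h id
  rw [h']
  exact ha

lemma le_finset_sup {S : Finset ℕ} {a : ℕ} (h : a ∈ S) : a ≤ S.sup id :=
  Finset.le_sup (f := id) h

lemma mem_inversions {S : Finset ℕ} {x : ℕ} (hx : x ∈ inversions S) : 0 < x ∧ x ≤ S.card := by
  simp only [inversions, Multiset.mem_map, Finset.mem_val, Finset.mem_sdiff,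
    Finset.mem_range] at hx
  obtain ⟨i, ⟨hi, -⟩, rfl⟩ := hx
  refine ⟨Finset.card_pos.2 ⟨S.sup id, Finset.mem_filter.2 ⟨?_, hi⟩⟩, Finset.card_filter_le _ _⟩
  apply finset_sup_mem
  rw [Finset.nonempty_iff_ne_empty]
  rintro rfl
  simp at hi

lemma card_inversions {S : Finset ℕ} (h : S.Nonempty) :
    (inversions S).card + S.card = S.sup id + 1 := by
  have hsub : S ⊆ Finset.range (S.sup id + 1) := fun a ha =>
    Finset.mem_range.2 (Nat.lt_succ_of_le (le_finset_sup ha))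
  have heq : Finset.range (S.sup id) \ S = Finset.range (S.sup id + 1) \ S := by
    ext i
    simp only [Finset.mem_sdiff, Finset.mem_range]
    refine ⟨fun hi => ⟨by omega, hi.2⟩, fun hi => ⟨?_, hi.2⟩⟩
    have : i ≠ S.sup id := by
      rintro rfl
      exact hi.2 (finset_sup_mem h)
    omega
  rw [inversions, Multiset.card_map, heq, Finset.card_val, Finset.card_sdiff_add_card_eq_card hsub,
    Finset.card_range]

lemma eq_range_of_inversions_eq_zero {S : Finset ℕ} (h : S.Nonempty) (h0 : inversions S = 0) :
    S = Finset.range S.card := by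
  have hc := card_inversions h
  rw [h0, Multiset.card_zero] at hc
  refine Finset.eq_of_subset_of_card_le (fun a ha => ?_) (by simp)
  have := le_finset_sup ha
  rw [Finset.mem_range]
  omega

lemma inversions_range (s : ℕ) : inversions (Finset.range s) = 0 := by
  rw [inversions, Multiset.map_eq_zero, Finset.val_eq_zero, Finset.sdiff_eq_empty_iff_subset]
  intro i hi
  rw [Finset.mem_range] at hi ⊢
  by_contra hlt
  have : (Finset.range s).sup id ≤ s := Finset.sup_le fun b hb => (Finset.mem_range.1 hb).le
  omega

lemma sum_rank (S : Finset ℕ) :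
    2 * ∑ a ∈ S, (S.filter (fun i => i < a)).card + S.card = S.card ^ 2 := by
  induction S using Finset.induction_on_max with
  | empty => simp
  | insert a S hmax ih =>
    have ha : a ∉ S := fun h => lt_irrefl _ (hmax a h)
    have h1 : ((insert a S).filter (fun i => i < a)) = S := by
      rw [Finset.filter_insert, if_neg (lt_irrefl a)]
      exact Finset.filter_true_of_mem hmax
    have h2 : ∀ b ∈ S, ((insert a S).filter (fun i => i < b)) = S.filter (fun i => i < b) := by
      intro b hb
      rw [Finset.filter_insert, if_neg (hmax b hb).asymm]
    rw [Finset.sum_insert ha, h1, Finset.sum_congr rfl (fun b hb => by rw [h2 b hb]),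
      Finset.card_insert_of_notMem ha]
    nlinarith

lemma sum_inversions (S : Finset ℕ) :
    ∑ a ∈ S, (2 * a + 1) = S.card ^ 2 + 2 * (inversions S).sum := by
  have h1 : (inversions S).sum =
      ∑ a ∈ S, ((Finset.range (S.sup id) \ S).filter (fun i => i < a)).card := by
    change ∑ i ∈ Finset.range (S.sup id) \ S, (S.filter (fun a => i < a)).card = _
    exact Finset.sum_card_bipartiteAbove_eq_sum_card_bipartiteBelow (fun i a => i < a)
  have h2 : ∀ a ∈ S, a = (S.filter (fun i => i < a)).card +
      ((Finset.range (S.sup id) \ S).filter (fun i => i < a)).card := by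
    intro a ha
    rw [← Finset.card_union_of_disjoint]
    · conv_lhs => rw [← Finset.card_range a]
      congr 1
      ext i
      have := le_finset_sup ha
      simp only [Finset.mem_range, Finset.mem_union, Finset.mem_filter, Finset.mem_sdiff]
      constructor
      · intro hi
        by_cases his : i ∈ S
        · exact Or.inl ⟨his, hi⟩
        · exact Or.inr ⟨⟨by omega, his⟩, hi⟩
      · rintro (h | h) <;> exact h.2
    · rw [Finset.disjoint_left]
      intro i hi hi'
      exact (Finset.mem_sdiff.1 (Finset.mem_filter.1 hi').1).2 (Finset.mem_filter.1 hi).1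
  have h3 : ∑ a ∈ S, a = ∑ a ∈ S, (S.filter (fun i => i < a)).card + (inversions S).sum := by
    rw [h1, ← Finset.sum_add_distrib]
    exact Finset.sum_congr rfl h2
  have h4 := sum_rank S
  rw [Finset.sum_add_distrib, ← Finset.mul_sum, h3, Finset.sum_const, smul_eq_mul]
  omega

lemma add_card_filter_inversions {S : Finset ℕ} {a : ℕ} (ha : a ∈ S) :
    a + (S.filter (fun b => a < b)).card +
      ((inversions S).filter (fun x => x ≤ (S.filter (fun b => a < b)).card)).card =
      S.sup id := by
  have h1 : ((inversions S).filter (fun x => x ≤ (S.filter (fun b => a < b)).card)).card =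
      ((Finset.range (S.sup id) \ S).filter (fun i => a < i)).card := by
    rw [inversions, Multiset.filter_map, Multiset.card_map]
    change Finset.card ((Finset.range (S.sup id) \ S).filter _) = _
    congr 1
    refine Finset.filter_congr fun i hi => ?_
    have hi' := (Finset.mem_sdiff.1 hi).2
    simp only [Function.comp]
    constructor
    · intro hle
      by_contra hlt
      have hne : i ≠ a := by
        rintro rfl
        exact hi' ha
      have : (S.filter (fun b => a < b)).card < (S.filter (fun b => i < b)).card := by
        apply Finset.card_lt_card
        rw [Finset.ssubset_iff_of_subset]
        · exact ⟨a, Finset.mem_filter.2 ⟨ha, by omega⟩, by simp⟩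
        · intro b hb
          rw [Finset.mem_filter] at hb ⊢
          exact ⟨hb.1, by omega⟩
      omega
    · intro hlt
      apply Finset.card_le_card
      intro b hb
      rw [Finset.mem_filter] at hb ⊢
      exact ⟨hb.1, by omega⟩
  have hle := le_finset_sup ha
  have h2 : (S.filter (fun b => a < b)).card +
      ((Finset.range (S.sup id) \ S).filter (fun i => a < i)).card =
      (Finset.Ioc a (S.sup id)).card := by
    rw [← Finset.card_union_of_disjoint]
    · congr 1
      ext i
      simp only [Finset.mem_union, Finset.mem_filter, Finset.mem_sdiff, Finset.mem_range,
        Finset.mem_Ioc]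
      constructor
      · rintro (⟨h, h'⟩ | ⟨⟨h, -⟩, h'⟩)
        · exact ⟨h', le_finset_sup h⟩
        · exact ⟨h', h.le⟩
      · rintro ⟨h, h'⟩
        by_cases his : i ∈ S
        · exact Or.inl ⟨his, h⟩
        · refine Or.inr ⟨⟨lt_of_le_of_ne h' ?_, his⟩, h⟩
          rintro rfl
          exact his (finset_sup_mem ⟨a, ha⟩)
    · rw [Finset.disjoint_left]
      intro i hi hi'
      exact (Finset.mem_sdiff.1 (Finset.mem_filter.1 hi').1).2 (Finset.mem_filter.1 hi).1
  rw [Nat.card_Ioc] at h2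
  rw [h1]
  omega

lemma exists_card_filter_lt_eq (S : Finset ℕ) {v : ℕ} (hv : v < S.card) :
    ∃ a ∈ S, (S.filter (fun b => a < b)).card = v := by
  have hmaps : ∀ a ∈ S, (S.filter (fun b => a < b)).card ∈ Finset.range S.card := by
    intro a ha
    rw [Finset.mem_range]
    apply Finset.card_lt_card
    rw [Finset.filter_ssubset]
    exact ⟨a, ha, lt_irrefl a⟩
  have hinj : Set.InjOn (fun a => (S.filter (fun b => a < b)).card) S := by
    have key : ∀ a ∈ S, ∀ b ∈ S, a < b →
        (S.filter (fun c => b < c)).card < (S.filter (fun c => a < c)).card := by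
      intro a _ b hb hab
      apply Finset.card_lt_card
      rw [Finset.ssubset_iff_of_subset]
      · exact ⟨b, Finset.mem_filter.2 ⟨hb, hab⟩, by simp⟩
      · intro c hc
        rw [Finset.mem_filter] at hc ⊢
        exact ⟨hc.1, by omega⟩
    intro a ha b hb hab
    rcases lt_trichotomy a b with h | h | h
    · have := key a ha b hb h
      simp only at hab
      omega
    · exact h
    · have := key b hb a ha h
      simp only at hab
      omega
  obtain ⟨a, ha, h⟩ := Finset.surj_on_of_inj_on_of_card_le
    (fun a _ => (S.filter (fun b => a < b)).card) hmaps
    (fun a b ha hb h => hinj ha hb h) (by simp) v (Finset.mem_range.2 hv)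
  exact ⟨a, ha, h.symm⟩

lemma inversions_injective {S T : Finset ℕ} (hc : S.card = T.card)
    (h : inversions S = inversions T) : S = T := by
  refine Finset.eq_of_subset_of_card_le (fun a ha => ?_) hc.ge
  have hlt : (S.filter (fun b => a < b)).card < S.card := by
    apply Finset.card_lt_card
    rw [Finset.filter_ssubset]
    exact ⟨a, ha, lt_irrefl a⟩
  obtain ⟨b, hb, hb'⟩ := exists_card_filter_lt_eq T (hc ▸ hlt)
  have h1 := add_card_filter_inversions ha
  have h2 := add_card_filter_inversions hb
  have h3 := card_inversions ⟨a, ha⟩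
  have h4 := card_inversions ⟨b, hb⟩
  rw [hb', ← h] at h2
  rw [← h] at h4
  have : a = b := by omega
  rwa [this]

open Classical in
/-- The partitions counted by `podeu n` with exactly `s` odd parts. -/
noncomputable def evenGtOddWithCard (n s : ℕ) : Finset (Multiset ℕ) :=
  (partitionMultisets n).filter
    (fun M => EvenGtOddDistinct M ∧ (M.filter (fun x => Odd x)).card = s)

lemma mem_evenGtOddWithCard {n s : ℕ} {M : Multiset ℕ} :
    M ∈ evenGtOddWithCard n s ↔ M ∈ partitionMultisets n ∧ EvenGtOddDistinct M ∧
      (M.filter (fun x => Odd x)).card = s := by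
  classical
  unfold evenGtOddWithCard
  exact Finset.mem_filter

/-- The indices `i` of the odd parts `2 * i + 1` of `M`. -/
def oddIndices (M : Multiset ℕ) : Finset ℕ := ((M.filter (fun x => Odd x)).map (· / 2)).toFinset

/-- The halves of the even parts of `M`. -/
def evenHalves (M : Multiset ℕ) : Multiset ℕ := (M.filter (fun x => Even x)).map (· / 2)

lemma oddIndices_val {M : Multiset ℕ} (h : (M.filter (fun x => Odd x)).Nodup) :
    (oddIndices M).val = (M.filter (fun x => Odd x)).map (· / 2) := by
  rw [oddIndices, Multiset.toFinset_val, Multiset.dedup_eq_self]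
  refine Multiset.Nodup.map_on ?_ h
  intro a ha b hb hab
  have h1 := Nat.odd_iff.1 (Multiset.mem_filter.1 ha).2
  have h2 := Nat.odd_iff.1 (Multiset.mem_filter.1 hb).2
  omega

lemma eq_map_oddIndices_add {M : Multiset ℕ} (h : (M.filter (fun x => Odd x)).Nodup) :
    M = (oddIndices M).val.map (fun i => 2 * i + 1) + (evenHalves M).map (fun i => 2 * i) := by
  rw [oddIndices_val h, evenHalves, Multiset.map_map, Multiset.map_map]
  conv_lhs => rw [← Multiset.filter_add_not (fun x => Odd x) M]
  congr 1
  · conv_lhs => rw [← Multiset.map_id (M.filter (fun x => Odd x))]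
    refine Multiset.map_congr rfl fun x hx => ?_
    have := Nat.odd_iff.1 (Multiset.mem_filter.1 hx).2
    simp only [id, Function.comp]
    omega
  · simp only [Nat.not_odd_iff_even]
    conv_lhs => rw [← Multiset.map_id (M.filter (fun x => Even x))]
    refine Multiset.map_congr rfl fun x hx => ?_
    have := Nat.even_iff.1 (Multiset.mem_filter.1 hx).2
    simp only [id, Function.comp]
    omega

/-- The pairs `(S, v)` encoding the partitions with odd parts `2 * i + 1`, `i ∈ S`, smaller than
the even parts `2 * e`, `e ∈ v`, where `S` has `s` elements and the sum of all parts is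
`s ^ 2 + 2 * N`. -/
structure IsCode (s N : ℕ) (x : Finset ℕ × Multiset ℕ) : Prop where
  card : x.1.card = s
  pos : ∀ e ∈ x.2, 0 < e
  lt : ∀ i ∈ x.1, ∀ e ∈ x.2, i < e
  sum : (inversions x.1).sum + x.2.sum = N

lemma sum_eq_of_mem_evenGtOddWithCard {n s : ℕ} {M : Multiset ℕ}
    (h : M ∈ evenGtOddWithCard n s) :
    n = s ^ 2 + 2 * ((inversions (oddIndices M)).sum + (evenHalves M).sum) := by
  rw [mem_evenGtOddWithCard, mem_partitionMultisets] at h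
  obtain ⟨⟨-, hsum⟩, ⟨hnd, -⟩, hcard⟩ := h
  have h1 : (oddIndices M).card = s := by
    rw [← hcard, ← Finset.card_val, oddIndices_val hnd, Multiset.card_map]
  have h2 := eq_map_oddIndices_add hnd
  rw [← hsum]
  conv_lhs => rw [h2]
  have h3 := sum_inversions (oddIndices M)
  have h4 : ((evenHalves M).map (fun i => 2 * i)).sum = 2 * (evenHalves M).sum := by
    simpa using Multiset.sum_map_mul_left (s := evenHalves M) (a := 2) (f := id)
  rw [Multiset.sum_add, h4, mul_add, ← add_assoc, ← h1, ← h3]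
  rfl

lemma isCode_of_mem {n s N : ℕ} {M : Multiset ℕ} (hn : n = s ^ 2 + 2 * N)
    (h : M ∈ evenGtOddWithCard n s) : IsCode s N (oddIndices M, evenHalves M) := by
  have hsum := sum_eq_of_mem_evenGtOddWithCard h
  rw [mem_evenGtOddWithCard, mem_partitionMultisets] at h
  obtain ⟨⟨hpos, -⟩, ⟨hnd, hlt⟩, hcard⟩ := h
  have heven : ∀ e ∈ evenHalves M, 2 * e ∈ M := by
    intro e he
    rw [eq_map_oddIndices_add hnd]
    exact Multiset.mem_add.2 (Or.inr (Multiset.mem_map_of_mem _ he))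
  have hodd : ∀ i ∈ oddIndices M, 2 * i + 1 ∈ M := by
    intro i hi
    rw [eq_map_oddIndices_add hnd]
    exact Multiset.mem_add.2 (Or.inl (Multiset.mem_map_of_mem _ hi))
  refine ⟨?_, fun e he => ?_, fun i hi e he => ?_, ?_⟩
  · rw [← hcard, ← Finset.card_val, oddIndices_val hnd, Multiset.card_map]
  · have := hpos _ (heven e he)
    omega
  · have := hlt _ (heven e he) (by simp) _ (hodd i hi) (by simp)
    omega
  · simp only
    omega

lemma exists_codes {n s N : ℕ} (hn : n = s ^ 2 + 2 * N) :
    ∃ C : Finset (Finset ℕ × Multiset ℕ), C.card = (evenGtOddWithCard n s).card ∧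
      ∀ x ∈ C, IsCode s N x := by
  refine ⟨(evenGtOddWithCard n s).image (fun M => (oddIndices M, evenHalves M)), ?_, ?_⟩
  · refine Finset.card_image_of_injOn fun L hL M hM h => ?_
    rw [Finset.mem_coe, mem_evenGtOddWithCard] at hL hM
    rw [eq_map_oddIndices_add hL.2.1.1, eq_map_oddIndices_add hM.2.1.1]
    simp only [Prod.mk.injEq] at h
    rw [h.1, h.2]
  · intro x hx
    obtain ⟨M, hM, rfl⟩ := Finset.mem_image.1 hx
    exact isCode_of_mem hn hM

lemma podeu_eq_sum (n : ℕ) :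
    podeu n = ∑ s ∈ Finset.range (n + 1), (evenGtOddWithCard n s).card := by
  classical
  rw [podeu, natCard_partition_subtype,
    Finset.card_eq_sum_card_fiberwise (f := fun M => (M.filter (fun x => Odd x)).card)
      (t := Finset.range (n + 1))]
  · refine Finset.sum_congr rfl fun s _ => ?_
    rw [evenGtOddWithCard, Finset.filter_filter]
  · intro M hM
    rw [Finset.mem_coe, Finset.mem_filter] at hM
    have hmem : M ∈ evenGtOddWithCard n (M.filter (fun x => Odd x)).card :=
      mem_evenGtOddWithCard.2 ⟨hM.1, hM.2, rfl⟩
    have := sum_eq_of_mem_evenGtOddWithCard hmem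
    have := Nat.le_self_pow two_ne_zero (M.filter (fun x => Odd x)).card
    exact Finset.mem_coe.2 (Finset.mem_range.2
      (by show (M.filter (fun x => Odd x)).card < n + 1; omega))

lemma card_codes_zero {N : ℕ} {C : Finset (Finset ℕ × Multiset ℕ)} (hC : ∀ x ∈ C, IsCode 0 N x) :
    C.card ≤ (partitionMultisets N).card := by
  have h0 : ∀ x ∈ C, x.1 = ∅ := fun x hx => Finset.card_eq_zero.1 (hC x hx).card
  refine Finset.card_le_card_of_injOn Prod.snd ?_ ?_
  · intro x hx
    have h := (hC x hx).sum
    rw [h0 x hx] at h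
    exact mem_partitionMultisets.2 ⟨(hC x hx).pos, by simpa [inversions] using h⟩
  · intro x hx y hy hxy
    exact Prod.ext ((h0 x hx).trans (h0 y hy).symm) hxy

lemma card_codes_one {N : ℕ} {C : Finset (Finset ℕ × Multiset ℕ)} (hC : ∀ x ∈ C, IsCode 1 N x)
    (hN : 2 ≤ N) :
    C.card + (partitionMultisets (N - 2)).card ≤ 2 * (partitionMultisets N).card := by
  have hS : ∀ x ∈ C, x.1 = {x.1.sup id} := by
    intro x hx
    obtain ⟨k, hk⟩ := Finset.card_eq_one.1 (hC x hx).card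
    rw [hk]
    simp
  have hsum : ∀ x ∈ C, x.1.sup id + x.2.sum = N := by
    intro x hx
    have h1 := (hC x hx).sum
    have h2 := sum_inversions x.1
    have h3 := (hC x hx).card
    rw [h3] at h2
    rw [hS x hx, Finset.sum_singleton, ← hS x hx] at h2
    omega
  have hlt : ∀ x ∈ C, ∀ e ∈ x.2, x.1.sup id < e := by
    intro x hx e he
    refine (hC x hx).lt _ (finset_sup_mem (Finset.card_pos.1 ?_)) e he
    rw [(hC x hx).card]
    exact one_pos
  have hext : ∀ x ∈ C, ∀ y ∈ C, x.1.sup id = y.1.sup id → x.2 = y.2 → x = y := by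
    intro x hx y hy h1 h2
    refine Prod.ext ?_ h2
    rw [hS x hx, hS y hy, h1]
  have hA : (C.filter (fun x => x.1.sup id = 0)).card ≤ (partitionMultisets N).card := by
    refine Finset.card_le_card_of_injOn Prod.snd ?_ ?_
    · intro x hx
      obtain ⟨hx, h0⟩ := Finset.mem_filter.1 hx
      have := hsum x hx
      exact mem_partitionMultisets.2 ⟨(hC x hx).pos, by omega⟩
    · intro x hx y hy hxy
      obtain ⟨hx, h0⟩ := Finset.mem_filter.1 hx
      obtain ⟨hy, h0'⟩ := Finset.mem_filter.1 hy
      exact hext x hx y hy (h0.trans h0'.symm) hxy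
  have hB : (C.filter (fun x => ¬ x.1.sup id = 0)).card + (partitionMultisets (N - 2)).card ≤
      (partitionMultisets N).card := by
    have h1 : (C.filter (fun x => ¬ x.1.sup id = 0)).card =
        ((C.filter (fun x => ¬ x.1.sup id = 0)).image (fun x => x.1.sup id ::ₘ x.2)).card := by
      refine (Finset.card_image_of_injOn fun x hx y hy hxy => ?_).symm
      obtain ⟨hx, -⟩ := Finset.mem_filter.1 hx
      obtain ⟨hy, -⟩ := Finset.mem_filter.1 hy
      have key : ∀ {x y : Finset ℕ × Multiset ℕ}, y ∈ C →
          x.1.sup id ::ₘ x.2 = y.1.sup id ::ₘ y.2 → y.1.sup id ≤ x.1.sup id := by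
        intro x y hy hxy
        have : x.1.sup id ∈ y.1.sup id ::ₘ y.2 := hxy ▸ Multiset.mem_cons_self _ _
        rcases Multiset.mem_cons.1 this with h | h
        · exact h.ge
        · exact (hlt y hy _ h).le
      have heq := le_antisymm (key hx hxy.symm) (key hy hxy)
      rw [heq, Multiset.cons_inj_right] at hxy
      exact hext x hx y hy heq hxy
    have h2 : (partitionMultisets (N - 2)).card =
        ((partitionMultisets (N - 2)).image (fun l => 1 ::ₘ 1 ::ₘ l)).card := by
      refine (Finset.card_image_of_injective _ fun l m hlm => ?_).symm
      simpa using hlm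
    rw [h1, h2, ← Finset.card_union_of_disjoint]
    · refine Finset.card_le_card fun l hl => ?_
      rw [mem_partitionMultisets]
      rcases Finset.mem_union.1 hl with hl | hl
      · obtain ⟨x, hx, rfl⟩ := Finset.mem_image.1 hl
        obtain ⟨hx, h0⟩ := Finset.mem_filter.1 hx
        refine ⟨fun i hi => ?_, by rw [Multiset.sum_cons]; exact hsum x hx⟩
        rcases Multiset.mem_cons.1 hi with rfl | hi
        · exact Nat.pos_of_ne_zero h0
        · exact (hC x hx).pos i hi
      · obtain ⟨m, hm, rfl⟩ := Finset.mem_image.1 hl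
        rw [mem_partitionMultisets] at hm
        refine ⟨fun i hi => ?_, ?_⟩
        · simp only [Multiset.mem_cons] at hi
          rcases hi with rfl | rfl | hi
          · exact one_pos
          · exact one_pos
          · exact hm.1 i hi
        · rw [Multiset.sum_cons, Multiset.sum_cons, hm.2]
          omega
    · rw [Finset.disjoint_left]
      intro l hl hl'
      obtain ⟨x, hx, rfl⟩ := Finset.mem_image.1 hl
      obtain ⟨m, -, hm⟩ := Finset.mem_image.1 hl'
      obtain ⟨hx, h0⟩ := Finset.mem_filter.1 hx
      have hlt' := hlt x hx
      have hcount := congrArg (Multiset.count 1) hm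
      have hc : Multiset.count 1 x.2 = 0 := by
        rw [Multiset.count_eq_zero]
        intro h1
        have := hlt' 1 h1
        omega
      rw [Multiset.count_cons_self, Multiset.count_cons_self, Multiset.count_cons, hc] at hcount
      split_ifs at hcount <;> omega
  have := Finset.card_filter_add_card_filter_not (s := C) (fun x => x.1.sup id = 0)
  omega

open Classical in
/-- A map from codes with `s` odd parts to partitions. The codes for which adding `inversions S`
and `v` loses information are treated separately. -/
noncomputable def codeToPartition (s : ℕ) (x : Finset ℕ × Multiset ℕ) : Multiset ℕ :=
  if x.1 = Finset.range s ∧ s ∈ x.2 then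
    (s + 1) ::ₘ (Multiset.replicate ((x.2.erase s).sup - 1) 1 +
      (x.2.erase s).erase (x.2.erase s).sup)
  else inversions x.1 + x.2

/-- `l` has a part which exceeds `s` by less than the number of parts that are at most `s`. -/
def HasPartInGap (s : ℕ) (l : Multiset ℕ) : Prop :=
  ∃ p ∈ l, s < p ∧ p < s + (l.filter (fun y => y ≤ s)).card

/-- The shape of the exceptional values of `codeToPartition`. -/
def IsExceptionalShape (s : ℕ) (l : Multiset ℕ) : Prop :=
  s + 1 ∈ l ∧ ∀ p ∈ l, p < s → p = 1

section

variable {s N : ℕ} {x y : Finset ℕ × Multiset ℕ}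

lemma IsCode.le_of_mem (hx : IsCode s N x) (hs : 2 ≤ s) {e : ℕ} (he : e ∈ x.2) :
    s + (inversions x.1).card ≤ e := by
  have hne : x.1.Nonempty := Finset.card_pos.1 (by rw [hx.card]; omega)
  have h1 := card_inversions hne
  have h2 := hx.lt _ (finset_sup_mem hne) e he
  rw [hx.card] at h1
  omega

lemma IsCode.lt_of_mem (hx : IsCode s N x) (hs : 2 ≤ s) (hgood : ¬ (x.1 = Finset.range s ∧ s ∈ x.2))
    {e : ℕ} (he : e ∈ x.2) : s < e := by
  have hne : x.1.Nonempty := Finset.card_pos.1 (by rw [hx.card]; omega)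
  have h1 := hx.le_of_mem hs he
  by_cases h0 : inversions x.1 = 0
  · have h2 := eq_range_of_inversions_eq_zero hne h0
    rw [hx.card] at h2
    have : e ≠ s := by
      rintro rfl
      exact hgood ⟨h2, he⟩
    omega
  · have := Multiset.card_pos.2 h0
    omega

lemma IsCode.filter_le (hx : IsCode s N x) (hs : 2 ≤ s)
    (hgood : ¬ (x.1 = Finset.range s ∧ s ∈ x.2)) :
    (codeToPartition s x).filter (fun y => y ≤ s) = inversions x.1 := by
  rw [codeToPartition, if_neg hgood, Multiset.filter_add,
    Multiset.filter_eq_self.2 fun a ha => hx.card ▸ (mem_inversions ha).2,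
    Multiset.filter_eq_nil.2 fun a ha => (hx.lt_of_mem hs hgood ha).not_ge, add_zero]

lemma IsCode.filter_not_le (hx : IsCode s N x) (hs : 2 ≤ s)
    (hgood : ¬ (x.1 = Finset.range s ∧ s ∈ x.2)) :
    (codeToPartition s x).filter (fun y => ¬ y ≤ s) = x.2 := by
  rw [codeToPartition, if_neg hgood, Multiset.filter_add,
    Multiset.filter_eq_nil.2 fun a ha => not_not.2 (hx.card ▸ (mem_inversions ha).2),
    Multiset.filter_eq_self.2 fun a ha => (hx.lt_of_mem hs hgood ha).not_ge, zero_add]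

lemma IsCode.not_hasPartInGap (hx : IsCode s N x) (hs : 2 ≤ s)
    (hgood : ¬ (x.1 = Finset.range s ∧ s ∈ x.2)) :
    ¬ HasPartInGap s (codeToPartition s x) := by
  rintro ⟨p, hp, hsp, hlt⟩
  rw [hx.filter_le hs hgood] at hlt
  have : p ∈ (codeToPartition s x).filter (fun y => ¬ y ≤ s) :=
    Multiset.mem_filter.2 ⟨hp, hsp.not_ge⟩
  rw [hx.filter_not_le hs hgood] at this
  have := hx.le_of_mem hs this
  omega

/-- Properties of the exceptional codes other than the one with `N = s`. -/
lemma IsCode.exceptional (hx : IsCode s N x) (hs : 2 ≤ s) (hN : N ≠ s)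
    (hbad : x.1 = Finset.range s ∧ s ∈ x.2) :
    (x.2.erase s).sup ∈ x.2.erase s ∧ s ≤ (x.2.erase s).sup ∧
      (∀ e ∈ (x.2.erase s).erase (x.2.erase s).sup, s ≤ e) ∧
      x.2.sum = N ∧ s + (x.2.erase s).sum = N := by
  have hle : ∀ e ∈ x.2, s ≤ e := fun e he => (Nat.le_add_right _ _).trans (hx.le_of_mem hs he)
  have hsum : x.2.sum = N := by
    have := hx.sum
    rwa [hbad.1, inversions_range, Multiset.sum_zero, zero_add] at this
  have hsum' : s + (x.2.erase s).sum = N := by rw [Multiset.sum_erase hbad.2, hsum]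
  have hne : x.2.erase s ≠ 0 := by
    intro h
    rw [h, Multiset.sum_zero] at hsum'
    omega
  have hmem := sup_mem_of_ne_zero hne
  exact ⟨hmem, hle _ (Multiset.mem_of_mem_erase hmem),
    fun e he => hle e (Multiset.mem_of_mem_erase (Multiset.mem_of_mem_erase he)), hsum, hsum'⟩

lemma IsCode.codeToPartition_mem (hx : IsCode s N x) (hs : 2 ≤ s) (hN : N ≠ s) :
    codeToPartition s x ∈ partitionMultisets N := by
  rw [mem_partitionMultisets]
  by_cases hbad : x.1 = Finset.range s ∧ s ∈ x.2
  · obtain ⟨hmem, hle, hle', -, hsum⟩ := hx.exceptional hs hN hbad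
    rw [codeToPartition, if_pos hbad]
    constructor
    · intro i hi
      rw [Multiset.mem_cons, Multiset.mem_add] at hi
      rcases hi with rfl | hi | hi
      · omega
      · rw [Multiset.eq_of_mem_replicate hi]
        exact one_pos
      · have := hle' i hi
        omega
    · have := Multiset.sum_erase hmem
      rw [Multiset.sum_cons, Multiset.sum_add, Multiset.sum_replicate, smul_eq_mul]
      omega
  · rw [codeToPartition, if_neg hbad]
    refine ⟨fun i hi => ?_, by rw [Multiset.sum_add, hx.sum]⟩
    rcases Multiset.mem_add.1 hi with hi | hi
    · exact (mem_inversions hi).1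
    · exact hx.pos i hi

lemma IsCode.isExceptionalShape (hx : IsCode s N x) (hs : 2 ≤ s) (hN : N ≠ s)
    (hbad : x.1 = Finset.range s ∧ s ∈ x.2) : IsExceptionalShape s (codeToPartition s x) := by
  obtain ⟨hmem, hle, hle', -, -⟩ := hx.exceptional hs hN hbad
  rw [codeToPartition, if_pos hbad]
  refine ⟨Multiset.mem_cons_self _ _, fun p hp hps => ?_⟩
  rw [Multiset.mem_cons, Multiset.mem_add] at hp
  rcases hp with rfl | hp | hp
  · omega
  · exact Multiset.eq_of_mem_replicate hp
  · have := hle' p hp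
    omega

lemma IsCode.hasPartInGap (hx : IsCode s N x) (hs : 2 ≤ s) (hN : N ≠ s)
    (hN2 : s = 2 → N ≠ 4) (hbad : x.1 = Finset.range s ∧ s ∈ x.2) :
    HasPartInGap s (codeToPartition s x) := by
  obtain ⟨hmem, hle, hle', -, hsum⟩ := hx.exceptional hs hN hbad
  rw [codeToPartition, if_pos hbad]
  refine ⟨s + 1, Multiset.mem_cons_self _ _, Nat.lt_succ_self s, ?_⟩
  rw [Multiset.filter_cons_of_neg _ (by omega), Multiset.filter_add,
    Multiset.filter_eq_self.2 (fun a ha => by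
      rw [Multiset.eq_of_mem_replicate ha]
      omega), Multiset.card_add, Multiset.card_replicate]
  set r := x.2.erase s
  suffices h : r.sup = 2 → 0 < ((r.erase r.sup).filter (fun y => y ≤ s)).card by
    by_cases h2 : r.sup = 2
    · have := h h2
      omega
    · omega
  intro h2
  have hs2 : s = 2 := by omega
  have hself : (r.erase r.sup).filter (fun y => y ≤ s) = r.erase r.sup := by
    rw [Multiset.filter_eq_self]
    intro a ha
    have := Multiset.le_sup (Multiset.mem_of_mem_erase ha)
    omega
  rw [hself, Multiset.card_pos]
  intro h0
  have h3 := Multiset.sum_erase hmem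
  rw [h0, Multiset.sum_zero] at h3
  have := hN2 hs2
  omega

lemma codeToPartition_injective (hx : IsCode s N x) (hy : IsCode s N y) (hs : 2 ≤ s)
    (hN : N ≠ s) (hN2 : s = 2 → N ≠ 4) (h : codeToPartition s x = codeToPartition s y) :
    x = y := by
  by_cases hbx : x.1 = Finset.range s ∧ s ∈ x.2
  · by_cases hby : y.1 = Finset.range s ∧ s ∈ y.2
    · obtain ⟨hmem, hle, hle', -, -⟩ := hx.exceptional hs hN hbx
      obtain ⟨hmem', hle2, hle2', -, -⟩ := hy.exceptional hs hN hby
      rw [codeToPartition, codeToPartition, if_pos hbx, if_pos hby, Multiset.cons_inj_right] at h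
      have hc := congrArg (Multiset.count 1) h
      rw [Multiset.count_add, Multiset.count_add, Multiset.count_replicate_self,
        Multiset.count_replicate_self,
        Multiset.count_eq_zero.2 (fun h1 => by have := hle' 1 h1; omega),
        Multiset.count_eq_zero.2 (fun h1 => by have := hle2' 1 h1; omega)] at hc
      have hsup : (x.2.erase s).sup = (y.2.erase s).sup := by omega
      rw [hsup, add_right_inj] at h
      refine Prod.ext (hbx.1.trans hby.1.symm) ?_
      rw [← Multiset.cons_erase hbx.2, ← Multiset.cons_erase hmem, hsup, h,
        Multiset.cons_erase hmem', Multiset.cons_erase hby.2]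
    · exact absurd (h ▸ hx.hasPartInGap hs hN hN2 hbx) (hy.not_hasPartInGap hs hby)
  · by_cases hby : y.1 = Finset.range s ∧ s ∈ y.2
    · exact absurd (h.symm ▸ hy.hasPartInGap hs hN hN2 hby) (hx.not_hasPartInGap hs hbx)
    · have h1 := hx.filter_le hs hbx
      have h2 := hx.filter_not_le hs hbx
      rw [h, hy.filter_le hs hby] at h1
      rw [h, hy.filter_not_le hs hby] at h2
      exact Prod.ext (inversions_injective (hx.card.trans hy.card.symm) h1.symm) h2.symm

end

lemma card_codes_add_le {s N : ℕ} {C : Finset (Finset ℕ × Multiset ℕ)}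
    (hC : ∀ x ∈ C, IsCode s N x) (hs : 2 ≤ s) (hN : N ≠ s) (hN2 : s = 2 → N ≠ 4)
    {R : Finset (Multiset ℕ)} (hR : R ⊆ partitionMultisets N)
    (hgap : ∀ l ∈ R, HasPartInGap s l) (hshape : ∀ l ∈ R, ¬ IsExceptionalShape s l) :
    C.card + R.card ≤ (partitionMultisets N).card := by
  have h1 : C.card = (C.image (codeToPartition s)).card :=
    (Finset.card_image_of_injOn fun x hx y hy h =>
      codeToPartition_injective (hC x hx) (hC y hy) hs hN hN2 h).symm
  rw [h1, ← Finset.card_union_of_disjoint]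
  · refine Finset.card_le_card (Finset.union_subset ?_ hR)
    intro l hl
    obtain ⟨x, hx, rfl⟩ := Finset.mem_image.1 hl
    exact (hC x hx).codeToPartition_mem hs hN
  · rw [Finset.disjoint_left]
    intro l hl hlR
    obtain ⟨x, hx, rfl⟩ := Finset.mem_image.1 hl
    by_cases hbad : x.1 = Finset.range s ∧ s ∈ x.2
    · exact hshape _ hlR ((hC x hx).isExceptionalShape hs hN hbad)
    · exact (hC x hx).not_hasPartInGap hs hbad (hgap _ hlR)

lemma card_codes_self_le {s : ℕ} {C : Finset (Finset ℕ × Multiset ℕ)}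
    (hC : ∀ x ∈ C, IsCode s s x) (hs : 2 ≤ s) :
    C.card ≤ (partitionMultisets s).card + 1 := by
  classical
  have hbad : (C.filter (fun x => x.1 = Finset.range s ∧ s ∈ x.2)).card ≤ 1 := by
    rw [Finset.card_le_one]
    have key : ∀ x ∈ C.filter (fun x => x.1 = Finset.range s ∧ s ∈ x.2),
        x = (Finset.range s, {s}) := by
      intro x hx
      obtain ⟨hx, hb⟩ := Finset.mem_filter.1 hx
      have hsum := (hC x hx).sum
      rw [hb.1, inversions_range, Multiset.sum_zero, zero_add, ← Multiset.sum_erase hb.2] at hsum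
      have h0 : x.2.erase s = 0 := by
        rw [Multiset.eq_zero_iff_forall_notMem]
        intro a ha
        have h1 := (hC x hx).pos a (Multiset.mem_of_mem_erase ha)
        have h2 := Multiset.single_le_sum (fun _ _ => Nat.zero_le _) a ha
        omega
      refine Prod.ext hb.1 ?_
      rw [← Multiset.cons_erase hb.2, h0]
      rfl
    intro x hx y hy
    rw [key x hx, key y hy]
  have hgood : (C.filter (fun x => ¬ (x.1 = Finset.range s ∧ s ∈ x.2))).card ≤
      (partitionMultisets s).card := by
    refine Finset.card_le_card_of_injOn (codeToPartition s) ?_ ?_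
    · intro x hx
      obtain ⟨hx, hb⟩ := Finset.mem_filter.1 hx
      refine mem_partitionMultisets.2 ?_
      rw [codeToPartition, if_neg hb]
      refine ⟨fun i hi => ?_, by rw [Multiset.sum_add, (hC x hx).sum]⟩
      rcases Multiset.mem_add.1 hi with hi | hi
      · exact (mem_inversions hi).1
      · exact (hC x hx).pos i hi
    · intro x hx y hy h
      obtain ⟨hx, hbx⟩ := Finset.mem_filter.1 hx
      obtain ⟨hy, hby⟩ := Finset.mem_filter.1 hy
      have h1 := (hC x hx).filter_le hs hbx
      have h2 := (hC x hx).filter_not_le hs hbx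
      rw [h, (hC y hy).filter_le hs hby] at h1
      rw [h, (hC y hy).filter_not_le hs hby] at h2
      exact Prod.ext
        (inversions_injective ((hC x hx).card.trans (hC y hy).card.symm) h1.symm) h2.symm
  have := Finset.card_filter_add_card_filter_not (s := C)
    (fun x => x.1 = Finset.range s ∧ s ∈ x.2)
  omega

/-- The number of partitions of `n` into parts of size at most `L`. -/
def boundedCount (L n : ℕ) : ℕ :=
  ((partitionMultisets n).filter (fun l => ∀ i ∈ l, i ≤ L)).card

lemma boundedCount_eq_card {L n : ℕ} (h : n ≤ L) :
    boundedCount L n = (partitionMultisets n).card := by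
  rw [boundedCount, Finset.filter_true_of_mem]
  intro l hl i hi
  have := Multiset.le_sum_of_mem hi
  rw [(mem_partitionMultisets.1 hl).2] at this
  omega

lemma boundedCount_zero (n : ℕ) : boundedCount 0 n = if n = 0 then 1 else 0 := by
  split_ifs with h
  · subst h
    rw [boundedCount_eq_card le_rfl]
    rfl
  · rw [boundedCount, Finset.card_eq_zero, Finset.filter_eq_empty_iff]
    intro l hl hle
    obtain ⟨hpos, hsum⟩ := mem_partitionMultisets.1 hl
    have hl0 : l = 0 := by
      refine Multiset.eq_zero_of_forall_notMem fun i hi => ?_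
      have := hpos i hi
      have := hle i hi
      omega
    subst hl0
    exact h (by simpa using hsum.symm)

lemma boundedCount_succ (L n : ℕ) :
    boundedCount (L + 1) n =
      boundedCount L n + if L + 1 ≤ n then boundedCount (L + 1) (n - (L + 1)) else 0 := by
  have hsplit : boundedCount (L + 1) n =
      (((partitionMultisets n).filter (fun l => ∀ i ∈ l, i ≤ L + 1)).filter
        (fun l => L + 1 ∉ l)).card +
      (((partitionMultisets n).filter (fun l => ∀ i ∈ l, i ≤ L + 1)).filter
        (fun l => ¬ L + 1 ∉ l)).card := (Finset.card_filter_add_card_filter_not _).symm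
  rw [hsplit]
  congr 1
  · rw [boundedCount, Finset.filter_filter]
    congr 1
    refine Finset.filter_congr fun l _ =>
      ⟨fun h i hi => ?_, fun h => ⟨fun i hi => ?_, fun hL => ?_⟩⟩
    · have := h.1 i hi
      have : i ≠ L + 1 := fun h' => h.2 (h' ▸ hi)
      omega
    · have := h i hi
      omega
    · have := h _ hL
      omega
  · split_ifs with hn
    · rw [boundedCount]
      symm
      refine Finset.card_bij (fun l _ => (L + 1) ::ₘ l) ?_ ?_ ?_
      · intro l hl
        simp only [Finset.mem_filter, mem_partitionMultisets] at hl ⊢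
        obtain ⟨⟨hpos, hsum⟩, hle⟩ := hl
        refine ⟨⟨⟨?_, ?_⟩, ?_⟩, ?_⟩
        · intro i hi
          rcases Multiset.mem_cons.1 hi with rfl | hi
          · omega
          · exact hpos i hi
        · rw [Multiset.sum_cons, hsum]
          omega
        · intro i hi
          rcases Multiset.mem_cons.1 hi with rfl | hi
          · omega
          · exact hle i hi
        · simp
      · intro l _ l' _ h
        exact (Multiset.cons_inj_right _).1 h
      · intro l hl
        simp only [Finset.mem_filter, mem_partitionMultisets, not_not] at hl
        obtain ⟨⟨⟨hpos, hsum⟩, hle⟩, hmem⟩ := hl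
        refine ⟨l.erase (L + 1), ?_, Multiset.cons_erase hmem⟩
        simp only [Finset.mem_filter, mem_partitionMultisets]
        refine ⟨⟨fun i hi => hpos i (Multiset.mem_of_mem_erase hi), ?_⟩,
          fun i hi => hle i (Multiset.mem_of_mem_erase hi)⟩
        have := Multiset.sum_erase hmem
        omega
    · rw [Finset.card_eq_zero, Finset.filter_eq_empty_iff]
      intro l hl
      simp only [Finset.mem_filter, mem_partitionMultisets] at hl
      intro hmem
      have := Multiset.le_sum_of_mem (not_not.1 hmem)
      omega

/-- Given a row `f` (as the list `xs`), the row `g` with `g n = f n + g (n - L)`, computed in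
chunks of length `L`; `prev` is the preceding chunk of `g` and `k` bounds the number of chunks. -/
def extendRow (L : ℕ) : ℕ → List ℕ → List ℕ → List ℕ
  | 0, _, _ => []
  | k + 1, prev, xs =>
    List.zipWith Nat.add (xs.take L) prev ++
      extendRow L k (List.zipWith Nat.add (xs.take L) prev) (xs.drop L)

lemma zipWith_add_map_range (f g : ℕ → ℕ) (a b : ℕ) :
    List.zipWith Nat.add ((List.range a).map f) ((List.range b).map g) =
      (List.range (min a b)).map (fun i => f i + g i) := by
  apply List.ext_getElem <;> simp

lemma extendRow_eq {L : ℕ} {f g h : ℕ → ℕ} (hg : ∀ n, g n = f n + h n)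
    (hh : ∀ n, h (n + L) = g n) (k m w : ℕ) (hw : w ≤ k * L) :
    extendRow L k ((List.range L).map (fun i => h (m + i)))
      ((List.range w).map (fun i => f (m + i))) = (List.range w).map (fun i => g (m + i)) := by
  induction k generalizing m w with
  | zero =>
    have : w = 0 := by omega
    subst this
    simp [extendRow]
  | succ k ih =>
    have hchunk : List.zipWith Nat.add (((List.range w).map (fun i => f (m + i))).take L)
        ((List.range L).map (fun i => h (m + i))) =
        (List.range (min w L)).map (fun i => g (m + i)) := by
      rw [← List.map_take, List.take_range, zipWith_add_map_range]
      simp only [hg]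
      congr 2
      omega
    have hdrop : ((List.range w).map (fun i => f (m + i))).drop L =
        (List.range (w - L)).map (fun i => f (m + L + i)) := by
      apply List.ext_getElem <;> simp [add_assoc]
    rw [extendRow, hchunk, hdrop]
    rcases le_total w L with hwL | hwL
    · have h0 : w - L = 0 := by omega
      have hnil : ∀ k (p : List ℕ), extendRow L k p [] = [] := by
        intro k
        induction k with
        | zero => intro p; rfl
        | succ k ih => intro p; simp [extendRow, ih]
      rw [h0, min_eq_left hwL, List.range_zero, List.map_nil, hnil, List.append_nil]
    · have h1 : (List.range L).map (fun i => g (m + i)) =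
          (List.range L).map (fun i => h (m + L + i)) := by
        refine List.map_congr_left fun i _ => ?_
        rw [← hh (m + i)]
        congr 1
        omega
      rw [min_eq_right hwL]
      conv_lhs => rw [h1]
      rw [ih (m + L) (w - L) (by rw [Nat.succ_mul] at hw; omega), ← h1]
      conv_rhs => rw [show w = L + (w - L) by omega, List.range_add, List.map_append, List.map_map]
      congr 1
      refine List.map_congr_left fun i _ => ?_
      simp [add_assoc]

/-- A lower bound, up to the offset `191218`, for `growthDefect L n` when `L ≤ 166`, `n < 166`. -/
def tableBound (L n : ℕ) : ℕ :=
  bif Nat.ble n 44 then 0 else bif Nat.ble L 8 then 191218 else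
  bif Nat.ble n 82 then 0 else bif Nat.ble n 149 then 191220 else
  bif Nat.beq L 9 then 16062314 else 191220

/-- Check the bound `tableBound L` along three rows, starting with index `n`. -/
def checkRow (L : ℕ) : ℕ → List ℕ → List ℕ → List ℕ → Bool
  | n, x :: xs, y :: ys, z :: zs =>
    bif Nat.ble (Nat.add x (tableBound L n)) (Nat.add (Nat.add y z) 191218) then
      checkRow L (Nat.succ n) xs ys zs else false
  | _, _, _, _ => true

/-- Check the bounds `tableBound` for `k` rows, starting with row `L`. -/
def checkRows : ℕ → ℕ → List ℕ → Bool
  | 0, _, _ => true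
  | k + 1, L, row =>
    bif checkRow L 0 row (List.replicate 2 0 ++ row) (List.replicate 11 0 ++ row) then
      checkRows k (Nat.succ L)
        (extendRow (Nat.succ L) 166 (List.replicate (Nat.succ L) 0) row)
    else false

lemma checkRows_eq_true : checkRows 167 0 (1 :: List.replicate 165 0) = true := by
  decide +kernel

lemma le_of_checkRow {L n : ℕ} {xs ys zs : List ℕ} (h : checkRow L n xs ys zs = true)
    {i x y z : ℕ} (hx : xs[i]? = some x) (hy : ys[i]? = some y) (hz : zs[i]? = some z) :
    x + tableBound L (n + i) ≤ y + z + 191218 := by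
  induction xs generalizing n ys zs i with
  | nil => simp at hx
  | cons a xs ih =>
    cases ys with
    | nil => simp at hy
    | cons b ys =>
      cases zs with
      | nil => simp at hz
      | cons c zs =>
        rw [checkRow, Bool.cond_eq_ite, ite_eq_iff] at h
        obtain ⟨h1, h2⟩ | ⟨-, h2⟩ := h
        · cases i with
          | zero =>
            simp only [List.getElem?_cons_zero, Option.some.injEq] at hx hy hz
            subst hx hy hz
            exact Nat.le_of_ble_eq_true h1
          | succ i =>
            simp only [List.getElem?_cons_succ] at hx hy hz
            have := ih h2 hx hy hz
            rwa [Nat.succ_add_eq_add_succ] at this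
        · exact absurd h2 Bool.false_ne_true

lemma checkRow_of_checkRows {L k j : ℕ} (hj : j < k)
    (h : checkRows k L ((List.range 166).map (boundedCount L)) = true) :
    checkRow (L + j) 0 ((List.range 166).map (boundedCount (L + j)))
      (List.replicate 2 0 ++ (List.range 166).map (boundedCount (L + j)))
      (List.replicate 11 0 ++ (List.range 166).map (boundedCount (L + j))) = true := by
  induction k generalizing L j with
  | zero => omega
  | succ k ih =>
    rw [checkRows, Bool.cond_eq_ite, ite_eq_iff] at h
    obtain ⟨h1, h2⟩ | ⟨-, h2⟩ := h
    · cases j with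
      | zero => exact h1
      | succ j =>
        have hrow := extendRow_eq (L := L + 1) (f := boundedCount L) (g := boundedCount (L + 1))
          (h := fun n => if L + 1 ≤ n then boundedCount (L + 1) (n - (L + 1)) else 0)
          (boundedCount_succ L) (by simp) 166 0 166 (by omega)
        simp only [zero_add] at hrow
        have hprev : (List.range (L + 1)).map
            (fun n => if L + 1 ≤ n then boundedCount (L + 1) (n - (L + 1)) else 0) =
            List.replicate (L + 1) 0 := by
          refine List.eq_replicate_iff.2 ⟨by simp, fun b hb => ?_⟩
          obtain ⟨i, hi, rfl⟩ := List.mem_map.1 hb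
          have := List.mem_range.1 hi
          exact if_neg (by omega)
        rw [hprev] at hrow
        have := ih (j := j) (L := L + 1) (by omega) (hrow ▸ h2)
        rwa [show L + 1 + j = L + (j + 1) by omega] at this
    · exact absurd h2 Bool.false_ne_true

/-- The number of partitions of `n - a` into parts of size at most `L`, `0` if `n < a`. -/
def laggedCount (a L n : ℕ) : ℕ := if a ≤ n then boundedCount L (n - a) else 0

lemma laggedCount_succ (a L n : ℕ) :
    laggedCount a (L + 1) n =
      laggedCount a L n + if L + 1 ≤ n then laggedCount a (L + 1) (n - (L + 1)) else 0 := by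
  unfold laggedCount
  by_cases ha : a ≤ n
  · rw [if_pos ha, if_pos ha, boundedCount_succ]
    by_cases h : L + 1 ≤ n - a
    · rw [if_pos h, if_pos (by omega), if_pos (by omega), Nat.sub_right_comm]
    · rw [if_neg h]
      split_ifs <;> first | rfl | omega
  · rw [if_neg ha, if_neg ha]
    split_ifs <;> first | rfl | omega

/-- The coefficient of `q ^ n` in `(q ^ 11 + q ^ 2 - 1) / ((1 - q) ⋯ (1 - q ^ L))`. -/
def growthDefect (L n : ℕ) : ℤ :=
  laggedCount 11 L n + laggedCount 2 L n - boundedCount L n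

lemma growthDefect_succ_of_le {L n : ℕ} (h : L + 1 ≤ n) :
    growthDefect (L + 1) n = growthDefect L n + growthDefect (L + 1) (n - (L + 1)) := by
  unfold growthDefect
  rw [laggedCount_succ 11 L n, laggedCount_succ 2 L n, boundedCount_succ L n, if_pos h, if_pos h,
    if_pos h]
  push_cast
  ring

lemma growthDefect_succ_of_lt {L n : ℕ} (h : n < L + 1) :
    growthDefect (L + 1) n = growthDefect L n := by
  unfold growthDefect
  rw [laggedCount_succ 11 L n, laggedCount_succ 2 L n, boundedCount_succ L n,
    if_neg h.not_ge, if_neg h.not_ge, if_neg h.not_ge]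
  simp

lemma growthDefect_eq_of_le {L n : ℕ} (h : n ≤ L) : growthDefect L n = growthDefect n n := by
  induction L, h using Nat.le_induction with
  | base => rfl
  | succ L h ih => rw [growthDefect_succ_of_lt (by omega), ih]

lemma growthDefect_zero_left {n : ℕ} (h : 12 ≤ n) : growthDefect 0 n = 0 := by
  simp only [growthDefect, laggedCount, boundedCount_zero]
  rw [if_pos (by omega : 11 ≤ n), if_pos (by omega : 2 ≤ n), if_neg (by omega : ¬ n - 11 = 0),
    if_neg (by omega : ¬ n - 2 = 0), if_neg (by omega : ¬ n = 0)]
  rfl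

lemma tableBound_le_growthDefect {L n : ℕ} (hL : L ≤ 166) (hn : n < 166) :
    (tableBound L n : ℤ) - 191218 ≤ growthDefect L n := by
  have hrow : (List.range 166).map (boundedCount 0) = 1 :: List.replicate 165 0 := by
    rw [show boundedCount 0 = fun n => if n = 0 then 1 else 0 from funext boundedCount_zero,
      List.range_succ_eq_map, List.map_cons, List.map_map]
    refine congrArg _ (List.eq_replicate_iff.2 ⟨by simp, fun b hb => ?_⟩)
    obtain ⟨i, -, rfl⟩ := List.mem_map.1 hb
    rfl
  have h := checkRow_of_checkRows (L := 0) (k := 167) (j := L) (by omega)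
    (hrow ▸ checkRows_eq_true)
  rw [zero_add] at h
  have hlag : ∀ a, (List.replicate a 0 ++ (List.range 166).map (boundedCount L))[n]? =
      some (laggedCount a L n) := by
    intro a
    unfold laggedCount
    split_ifs with ha
    · rw [List.getElem?_append_right (by simpa using ha), List.length_replicate,
        List.getElem?_map, List.getElem?_range (by omega)]
      rfl
    · rw [List.getElem?_append_left (by simpa using ha), List.getElem?_replicate,
        if_pos (by omega)]
  have hx : ((List.range 166).map (boundedCount L))[n]? = some (boundedCount L n) := by
    rw [List.getElem?_map, List.getElem?_range hn]
    rfl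
  have := le_of_checkRow h hx (hlag 2) (hlag 11)
  rw [zero_add] at this
  unfold growthDefect
  omega

lemma neg_le_growthDefect (L : ℕ) {n : ℕ} (hn : n < 166) : -191218 ≤ growthDefect L n := by
  rcases le_total L 166 with hL | hL
  · have := tableBound_le_growthDefect hL hn
    omega
  · rw [growthDefect_eq_of_le (by omega : n ≤ L)]
    have := tableBound_le_growthDefect hn.le hn
    omega

lemma growthDefect_nonneg {L n : ℕ} (hL : L ≤ 8) (hn : 45 ≤ n) : 0 ≤ growthDefect L n := by
  induction L generalizing n with
  | zero => exact (growthDefect_zero_left (by omega)).ge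
  | succ L ih =>
    induction n using Nat.strong_induction_on with
    | _ n ihn =>
      by_cases h : n < 45 + (L + 1)
      · have h1 := tableBound_le_growthDefect (L := L + 1) (n := n) (by omega) (by omega)
        have h2 : tableBound (L + 1) n = 191218 := by
          simp only [tableBound, Bool.cond_eq_ite, Nat.ble_eq, if_neg (show ¬ n ≤ 44 by omega),
            if_pos hL]
        omega
      · rw [growthDefect_succ_of_le (by omega)]
        have h1 := ih (n := n) (by omega) hn
        have h2 := ihn (n - (L + 1)) (by omega) (by omega)
        omega

lemma le_growthDefect_nine {n : ℕ} (hn : 150 ≤ n) : 15871096 ≤ growthDefect 9 n := by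
  induction n using Nat.strong_induction_on with
  | _ n ihn =>
    by_cases h : n < 159
    · have h1 := tableBound_le_growthDefect (L := 9) (n := n) (by omega) (by omega)
      have h2 : tableBound 9 n = 16062314 := by
        simp only [tableBound, Bool.cond_eq_ite, Nat.ble_eq, if_neg (show ¬ n ≤ 44 by omega),
          if_neg (show ¬ n ≤ 82 by omega), if_neg (show ¬ n ≤ 149 by omega)]
        rfl
      omega
    · rw [growthDefect_succ_of_le (by omega)]
      have h1 := growthDefect_nonneg (L := 8) (n := n) (by omega) (by omega)
      have h2 := ihn (n - 9) (by omega) (by omega)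
      simp only [Nat.reduceAdd]
      omega

lemma two_le_growthDefect {L n : ℕ} (hL : 9 ≤ L) (hn : 83 ≤ n) : 2 ≤ growthDefect L n := by
  induction n using Nat.strong_induction_on generalizing L with
  | _ n ihn =>
    by_cases h : n < 166
    · have key : ∀ l, 9 ≤ l → l ≤ 166 → 2 ≤ growthDefect l n := by
        intro l h9 hl
        have h1 := tableBound_le_growthDefect (L := l) (n := n) hl h
        have h2 : 191220 ≤ tableBound l n := by
          simp only [tableBound, Bool.cond_eq_ite, Nat.ble_eq, if_neg (show ¬ n ≤ 44 by omega),
            if_neg (show ¬ n ≤ 82 by omega), if_neg (show ¬ l ≤ 8 by omega)]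
          split_ifs <;> omega
        omega
      rcases le_total L 166 with hl | hl
      · exact key L hL hl
      · rw [growthDefect_eq_of_le (by omega : n ≤ L)]
        exact key n (by omega) (by omega)
    · have key : ∀ l, 9 ≤ l → l ≤ n →
          growthDefect 9 n - 191218 * ((l - (n - 83) : ℕ) : ℤ) ≤ growthDefect l n := by
        intro l h9
        induction l, h9 using Nat.le_induction with
        | base =>
          intro _
          have : 9 - (n - 83) = 0 := by omega
          rw [this]
          simp
        | succ l h9 ih =>
          intro hl
          have h1 := ih (by omega)
          rw [growthDefect_succ_of_le hl]
          by_cases hs : 83 ≤ n - (l + 1)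
          · have h2 := ihn (n - (l + 1)) (by omega) (L := l + 1) (by omega) hs
            omega
          · have h2 := neg_le_growthDefect (l + 1) (n := n - (l + 1)) (by omega)
            omega
      have h9 := le_growthDefect_nine (n := n) (by omega)
      rcases le_total L n with hl | hl
      · have := key L hL hl
        omega
      · rw [growthDefect_eq_of_le hl]
        have := key n (by omega) le_rfl
        omega

lemma card_partitionMultisets_add_two_le {n : ℕ} (hn : 83 ≤ n) :
    (partitionMultisets n).card + 2 ≤
      (partitionMultisets (n - 2)).card + (partitionMultisets (n - 11)).card := by
  have h := two_le_growthDefect (L := n) (by omega) hn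
  unfold growthDefect laggedCount at h
  rw [if_pos (by omega), if_pos (by omega), boundedCount_eq_card le_rfl,
    boundedCount_eq_card (by omega), boundedCount_eq_card (by omega)] at h
  omega

lemma shiftedCount_eq {n s N : ℕ} (h : n = s ^ 2 + 2 * N) :
    shiftedCount n s = (partitionMultisets N).card := by
  have h2 : s ^ 2 % 2 = s % 2 := by
    rcases Nat.mod_two_eq_zero_or_one s with h | h <;> simp [Nat.pow_mod, h]
  rw [shiftedCount, if_pos ⟨by omega, by omega⟩]
  congr 2
  omega

lemma exists_eq_of_evenGtOddWithCard_ne_empty {n s : ℕ} (h : evenGtOddWithCard n s ≠ ∅) :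
    ∃ N, n = s ^ 2 + 2 * N := by
  obtain ⟨M, hM⟩ := Finset.nonempty_iff_ne_empty.2 h
  exact ⟨_, sum_eq_of_mem_evenGtOddWithCard hM⟩

lemma card_evenGtOddWithCard_le {n s : ℕ} (hs : 3 ≤ s) :
    (evenGtOddWithCard n s).card ≤ shiftedCount n s + if n = s ^ 2 + 2 * s then 1 else 0 := by
  by_cases h : evenGtOddWithCard n s = ∅
  · simp [h]
  · obtain ⟨N, hN⟩ := exists_eq_of_evenGtOddWithCard_ne_empty h
    obtain ⟨C, hcard, hC⟩ := exists_codes hN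
    rw [shiftedCount_eq hN, ← hcard]
    by_cases hNs : N = s
    · subst hNs
      rw [if_pos hN]
      exact card_codes_self_le hC (by omega)
    · have := card_codes_add_le hC (by omega) hNs (by omega) (Finset.empty_subset _)
        (by simp) (by simp)
      rw [Finset.card_empty] at this
      omega

lemma sum_ite_eq_sq_le_one (n : ℕ) (S : Finset ℕ) :
    ∑ s ∈ S, (if n = s ^ 2 + 2 * s then 1 else 0) ≤ 1 := by
  rw [← Finset.sum_filter, Finset.sum_const, smul_eq_mul, mul_one]
  refine Finset.card_le_one.2 fun a ha b hb => ?_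
  have h1 := (Finset.mem_filter.1 ha).2
  have h2 := (Finset.mem_filter.1 hb).2
  rcases lt_trichotomy a b with h | h | h
  · nlinarith
  · exact h
  · nlinarith

lemma exists_subset_card_two {N : ℕ} (hN : 10 ≤ N) :
    ∃ R ⊆ partitionMultisets N, R.card = 2 ∧ (∀ l ∈ R, HasPartInGap 2 l) ∧
      ∀ l ∈ R, ¬ IsExceptionalShape 2 l := by
  have key : ∀ a b, 3 ≤ a + b → 4 + 2 * a + b = N →
      (4 ::ₘ (Multiset.replicate a 2 + Multiset.replicate b 1)) ∈ partitionMultisets N ∧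
      HasPartInGap 2 (4 ::ₘ (Multiset.replicate a 2 + Multiset.replicate b 1)) ∧
      ¬ IsExceptionalShape 2 (4 ::ₘ (Multiset.replicate a 2 + Multiset.replicate b 1)) := by
    intro a b hab hsum
    refine ⟨mem_partitionMultisets.2 ⟨?_, ?_⟩, ⟨4, by simp, by omega, ?_⟩, ?_⟩
    · intro i hi
      simp only [Multiset.mem_cons, Multiset.mem_add, Multiset.mem_replicate] at hi
      omega
    · simp only [Multiset.sum_cons, Multiset.sum_add, Multiset.sum_replicate, smul_eq_mul]
      omega
    · rw [Multiset.filter_cons_of_neg _ (by omega), Multiset.filter_eq_self.2]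
      · simp only [Multiset.card_add, Multiset.card_replicate]
        omega
      · intro i hi
        simp only [Multiset.mem_add, Multiset.mem_replicate] at hi
        omega
    · intro h
      have := h.1
      simp only [Multiset.mem_cons, Multiset.mem_add, Multiset.mem_replicate] at this
      omega
  obtain ⟨t, b, hb⟩ : ∃ t b, 3 ≤ t ∧ 4 + 2 * t + b = N ∧ b < 2 :=
    ⟨(N - 4) / 2, N % 2, by omega, by omega, by omega⟩
  have h1 := key t b (by omega) hb.2.1
  have h2 := key (t - 1) (b + 2) (by omega) (by omega)
  have hne : 4 ::ₘ (Multiset.replicate t 2 + Multiset.replicate b 1) ≠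
      4 ::ₘ (Multiset.replicate (t - 1) 2 + Multiset.replicate (b + 2) 1) := by
    intro h
    have := congrArg Multiset.card h
    simp only [Multiset.card_cons, Multiset.card_add, Multiset.card_replicate] at this
    omega
  refine ⟨_, ?_, Finset.card_pair hne, ?_, ?_⟩
  · exact Finset.insert_subset h1.1 (Finset.singleton_subset_iff.2 h2.1)
  · simpa only [Finset.forall_mem_insert, Finset.mem_singleton, forall_eq] using ⟨h1.2.1, h2.2.1⟩
  · simpa only [Finset.forall_mem_insert, Finset.mem_singleton, forall_eq] using ⟨h1.2.2, h2.2.2⟩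

lemma exists_subset_card_eq {N : ℕ} (hN : 7 ≤ N) :
    ∃ R ⊆ partitionMultisets N, R.card = (partitionMultisets (N - 7)).card ∧
      (∀ l ∈ R, HasPartInGap 3 l) ∧ ∀ l ∈ R, ¬ IsExceptionalShape 3 l := by
  refine ⟨(partitionMultisets (N - 7)).image (fun l => 4 ::ₘ 2 ::ₘ 1 ::ₘ l), ?_, ?_, ?_, ?_⟩
  · intro l hl
    obtain ⟨l', hl', rfl⟩ := Finset.mem_image.1 hl
    clear hl
    rw [mem_partitionMultisets] at hl' ⊢
    refine ⟨fun i hi => ?_, ?_⟩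
    · simp only [Multiset.mem_cons] at hi
      rcases hi with rfl | rfl | rfl | hi
      · omega
      · omega
      · omega
      · exact hl'.1 i hi
    · simp only [Multiset.sum_cons, hl'.2]
      omega
  · refine Finset.card_image_of_injective _ fun l l' h => ?_
    simpa using h
  · intro l hl
    obtain ⟨l, -, rfl⟩ := Finset.mem_image.1 hl
    refine ⟨4, by simp, by omega, ?_⟩
    rw [Multiset.filter_cons_of_neg _ (by omega), Multiset.filter_cons_of_pos _ (by omega),
      Multiset.filter_cons_of_pos _ (by omega)]
    simp only [Multiset.card_cons]
    omega
  · intro l hl h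
    obtain ⟨l, -, rfl⟩ := Finset.mem_image.1 hl
    have := h.2 2 (by simp) (by omega)
    omega

lemma evenGtOddWithCard_eq_empty {n s : ℕ} (h : n % 2 ≠ s ^ 2 % 2) :
    evenGtOddWithCard n s = ∅ := by
  by_contra hne
  obtain ⟨N, hN⟩ := exists_eq_of_evenGtOddWithCard_ne_empty hne
  omega

lemma sum_range_four_card_evenGtOddWithCard_add_two_le {n : ℕ} (hn : 373 ≤ n) :
    ∑ s ∈ Finset.range 4, (evenGtOddWithCard n s).card + 2 ≤
      ∑ s ∈ Finset.range 4, shiftedCount n s := by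
  simp only [Finset.sum_range_succ, Finset.sum_range_zero, zero_add]
  rcases Nat.mod_two_eq_zero_or_one n with hpar | hpar
  · have h0 : n = 0 ^ 2 + 2 * (n / 2) := by omega
    have h2 : n = 2 ^ 2 + 2 * (n / 2 - 2) := by omega
    rw [evenGtOddWithCard_eq_empty (by omega : n % 2 ≠ 1 ^ 2 % 2),
      evenGtOddWithCard_eq_empty (by omega : n % 2 ≠ 3 ^ 2 % 2), shiftedCount_eq h0,
      shiftedCount_eq h2]
    obtain ⟨C, hcard, hC⟩ := exists_codes h0
    obtain ⟨C', hcard', hC'⟩ := exists_codes h2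
    obtain ⟨R, hR, hRcard, hgap, hshape⟩ := exists_subset_card_two
      (N := n / 2 - 2) (by omega)
    have h3 := card_codes_zero hC
    have h4 := card_codes_add_le hC' le_rfl (by omega) (by omega) hR hgap hshape
    simp only [Finset.card_empty]
    omega
  · have h1 : n = 1 ^ 2 + 2 * (n / 2) := by omega
    have h3 : n = 3 ^ 2 + 2 * (n / 2 - 4) := by omega
    rw [evenGtOddWithCard_eq_empty (by omega : n % 2 ≠ 0 ^ 2 % 2),
      evenGtOddWithCard_eq_empty (by omega : n % 2 ≠ 2 ^ 2 % 2), shiftedCount_eq h1,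
      shiftedCount_eq h3]
    obtain ⟨C, hcard, hC⟩ := exists_codes h1
    obtain ⟨C', hcard', hC'⟩ := exists_codes h3
    obtain ⟨R, hR, hRcard, hgap, hshape⟩ := exists_subset_card_eq
      (N := n / 2 - 4) (by omega)
    have h4 := card_codes_one hC (by omega)
    have h5 := card_codes_add_le hC' (by omega) (by omega) (by omega) hR hgap hshape
    have h6 := card_partitionMultisets_add_two_le (n := n / 2) (by omega)
    rw [show n / 2 - 4 - 7 = n / 2 - 11 by omega] at hRcard
    simp only [Finset.card_empty]
    omega

theorem podeu_lt_peuod_of_ge_373 : ∀ n : ℕ, 373 ≤ n → podeu n < peuod n := by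
  intro n hn
  have h1 := sum_range_four_card_evenGtOddWithCard_add_two_le hn
  have h2 : ∑ s ∈ Finset.Ico 4 (n + 1), (evenGtOddWithCard n s).card ≤
      ∑ s ∈ Finset.Ico 4 (n + 1), shiftedCount n s + 1 := by
    calc _ ≤ ∑ s ∈ Finset.Ico 4 (n + 1),
          (shiftedCount n s + if n = s ^ 2 + 2 * s then 1 else 0) :=
        Finset.sum_le_sum fun s hs => card_evenGtOddWithCard_le
          (by have := (Finset.mem_Ico.1 hs).1; omega)
      _ ≤ _ := by
        rw [Finset.sum_add_distrib]
        exact Nat.add_le_add_left (sum_ite_eq_sq_le_one n _) _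
  have h3 := sum_shiftedCount_le_peuod n
  rw [podeu_eq_sum]
  rw [← Finset.sum_range_add_sum_Ico _ (by omega : 4 ≤ n + 1)] at h3 ⊢
  omega
end

section
/- For n ≥ 50, p_{od}^{eu}(n) < p_{eu}^{od}(n). -/
/-- The number of partitions of `m` into at most `k` parts. -/
def atMostParts : ℕ → ℕ → ℕ
  | 0, m => if m = 0 then 1 else 0
  | k + 1, m => atMostParts k m + if k + 1 ≤ m then atMostParts (k + 1) (m - (k + 1)) else 0
termination_by k m => (k, m)

/-- `atMostParts`, extended by zero to negative integers. -/
def atMostPartsInt (k : ℕ) (z : ℤ) : ℤ := if 0 ≤ z then (atMostParts k z.toNat : ℤ) else 0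

/-- The first difference of `atMostPartsInt k`; by conjugation it counts, for `1 ≤ k`, the
partitions of `z` into parts between `2` and `k`. -/
def partsTwoTo (k : ℕ) (z : ℤ) : ℤ := atMostPartsInt k z - atMostPartsInt k (z - 1)

lemma atMostPartsInt_of_neg (k : ℕ) {z : ℤ} (hz : z < 0) : atMostPartsInt k z = 0 := by
  simp [atMostPartsInt, not_le.mpr hz]

lemma atMostPartsInt_natCast (k m : ℕ) : atMostPartsInt k m = atMostParts k m := by
  simp [atMostPartsInt]

lemma atMostPartsInt_nonneg (k : ℕ) (z : ℤ) : 0 ≤ atMostPartsInt k z := by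
  unfold atMostPartsInt; split_ifs <;> positivity

lemma atMostPartsInt_succ (k : ℕ) (z : ℤ) :
    atMostPartsInt (k + 1) z = atMostPartsInt k z + atMostPartsInt (k + 1) (z - (k + 1)) := by
  rcases lt_or_ge z 0 with hz | hz
  · rw [atMostPartsInt_of_neg _ hz, atMostPartsInt_of_neg _ hz, atMostPartsInt_of_neg _ (by omega)]
    rfl
  lift z to ℕ using hz
  rw [atMostPartsInt_natCast, atMostPartsInt_natCast, atMostParts]
  split_ifs with h
  · have : (z : ℤ) - (k + 1) = ((z - (k + 1) : ℕ) : ℤ) := by omega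
    rw [this, atMostPartsInt_natCast]
    push_cast
    rfl
  · rw [atMostPartsInt_of_neg _ (by omega)]
    simp

lemma atMostPartsInt_one {z : ℤ} (hz : 0 ≤ z) : atMostPartsInt 1 z = 1 := by
  lift z to ℕ using hz
  induction z with
  | zero => simp [atMostPartsInt, atMostParts]
  | succ n ih =>
    rw [atMostPartsInt_succ]
    have : ((n + 1 : ℕ) : ℤ) - ((0 : ℕ) + 1) = n := by push_cast; ring
    rw [this, ih, atMostPartsInt_natCast]
    simp [atMostParts]

lemma partsTwoTo_of_neg (k : ℕ) {z : ℤ} (hz : z < 0) : partsTwoTo k z = 0 := by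
  rw [partsTwoTo, atMostPartsInt_of_neg _ hz, atMostPartsInt_of_neg _ (by omega), sub_zero]

lemma partsTwoTo_succ (k : ℕ) (z : ℤ) :
    partsTwoTo (k + 1) z = partsTwoTo k z + partsTwoTo (k + 1) (z - (k + 1)) := by
  unfold partsTwoTo
  rw [atMostPartsInt_succ k z, atMostPartsInt_succ k (z - 1),
    show z - 1 - ((k : ℤ) + 1) = z - (k + 1) - 1 by ring]
  ring

lemma partsTwoTo_one (z : ℤ) : partsTwoTo 1 z = if z = 0 then 1 else 0 := by
  unfold partsTwoTo
  rcases lt_trichotomy z 0 with h | h | h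
  · rw [atMostPartsInt_of_neg _ h, atMostPartsInt_of_neg _ (by omega), if_neg h.ne, sub_zero]
  · subst h
    rw [atMostPartsInt_one le_rfl, atMostPartsInt_of_neg _ (by omega), if_pos rfl, sub_zero]
  · rw [atMostPartsInt_one h.le, atMostPartsInt_one (by omega), if_neg h.ne', sub_self]

/-- Strong induction on the integers: to prove `p z` for all `z ≥ a`, it is enough to treat
the `d` values from `a` on and to pass from `z` to `z + d`. -/
lemma int_induction_step {p : ℤ → Prop} (a d : ℤ) (hd : 0 < d)
    (base : ∀ z, a ≤ z → z < a + d → p z) (step : ∀ z, a ≤ z → p z → p (z + d)) :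
    ∀ z, a ≤ z → p z := by
  suffices h : ∀ n : ℕ, ∀ z, a ≤ z → z < a + n → p z from
    fun z hz => h (z - a + 1).toNat z hz (by omega)
  intro n
  induction n with
  | zero => intro z h1 h2; omega
  | succ n ih =>
    intro z h1 h2
    rcases lt_or_ge z (a + d) with h | h
    · exact base z h1 h
    · have := step (z - d) (by omega) (ih _ (by omega) (by push_cast at h2; omega))
      rwa [sub_add_cancel] at this

lemma partsTwoTo_nonneg {k : ℕ} (hk : 1 ≤ k) (z : ℤ) : 0 ≤ partsTwoTo k z := by
  induction k, hk using Nat.le_induction generalizing z with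
  | base => rw [partsTwoTo_one]; split_ifs <;> norm_num
  | succ k hk ih =>
    rcases lt_or_ge z 0 with hz | hz
    · rw [partsTwoTo_of_neg _ hz]
    · refine int_induction_step (p := fun z => 0 ≤ partsTwoTo (k + 1) z) (-(k + 1)) (k + 1)
        (by positivity) ?_ ?_ z (by omega)
      · intro z _ h
        rw [partsTwoTo_of_neg _ (by omega)]
      · intro z _ h
        rw [partsTwoTo_succ, add_sub_cancel_right]
        exact add_nonneg (ih _) h

lemma partsTwoTo_le_succ {k : ℕ} (z : ℤ) : partsTwoTo k z ≤ partsTwoTo (k + 1) z := by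
  rw [partsTwoTo_succ]
  linarith [partsTwoTo_nonneg (k := k + 1) (by omega) (z - (k + 1))]

lemma partsTwoTo_mono {k l : ℕ} (h : k ≤ l) (z : ℤ) : partsTwoTo k z ≤ partsTwoTo l z :=
  monotone_nat_of_le_succ (f := fun k => partsTwoTo k z) (fun _ => partsTwoTo_le_succ z) h

lemma atMostPartsInt_mono {k : ℕ} (hk : 1 ≤ k) : Monotone (atMostPartsInt k) :=
  monotone_int_of_le_succ fun z => by
    have := partsTwoTo_nonneg hk (z + 1)
    rw [partsTwoTo, add_sub_cancel_right] at this
    linarith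

lemma partsTwoTo_two_le_one (z : ℤ) : partsTwoTo 2 z ≤ 1 := by
  rcases lt_or_ge z 0 with hz | hz
  · rw [partsTwoTo_of_neg _ hz]; norm_num
  · have key : ∀ z, 0 ≤ z → partsTwoTo 2 z ≤ 1 := by
      refine int_induction_step 0 2 (by norm_num) ?_ ?_
      · intro z h1 h2
        rw [partsTwoTo_succ 1, partsTwoTo_one, partsTwoTo_of_neg _ (by push_cast; omega)]
        split_ifs <;> norm_num
      · intro z h1 h2
        rw [partsTwoTo_succ 1, partsTwoTo_one, if_neg (by omega)]
        norm_num [h2]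
    exact key z hz

/-- A row of the table of `atMostParts`, computed from the previous one; the first argument
accumulates the new row in reverse. -/
def nextRow (k : ℕ) : List ℕ → List ℕ → List ℕ
  | acc, [] => acc.reverse
  | acc, a :: l => nextRow k ((a + acc.getD k 0) :: acc) l

/-- The values `atMostParts k m` for `m < N`. -/
def partsRow (N : ℕ) : ℕ → List ℕ
  | 0 => (List.range N).map fun m => if m = 0 then 1 else 0
  | k + 1 => nextRow k [] (partsRow N k)

lemma nextRow_eq (k n j : ℕ) :
    nextRow k ((List.range j).map (atMostParts (k + 1))).reverse
      ((List.range' j n).map (atMostParts k)) = (List.range (j + n)).map (atMostParts (k + 1)) := by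
  induction n generalizing j with
  | zero => simp [nextRow]
  | succ n ih =>
    rw [List.range'_succ, List.map_cons, nextRow, show j + (n + 1) = j + 1 + n by ring, ← ih]
    congr 1
    rw [List.range_succ, List.map_append, List.reverse_append]
    simp only [List.map_cons, List.map_nil, List.reverse_cons, List.reverse_nil, List.nil_append,
      List.singleton_append]
    congr 1
    conv_rhs => rw [atMostParts]
    congr 1
    split_ifs with h
    · rw [List.getD_eq_getElem _ _ (by simp; omega)]
      simp [show j - 1 - k = j - (k + 1) by omega]
    · rw [List.getD_eq_default _ _ (by simp; omega)]

lemma partsRow_eq (N k : ℕ) : partsRow N k = (List.range N).map (atMostParts k) := by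
  induction k with
  | zero => simp [partsRow, atMostParts]
  | succ k ih =>
    have := nextRow_eq k N 0
    rw [partsRow, ih]
    simpa [List.range_eq_range'] using this

lemma atMostParts_eq_getD (N : ℕ) {k m : ℕ} (h : m < N) :
    atMostParts k m = (partsRow N k).getD m 0 := by
  rw [partsRow_eq, List.getD_eq_getElem _ _ (by simpa)]
  simp

/-- `atMostPartsInt k z` for `z < N`, read off from the table. -/
def tableValue (N k : ℕ) (z : ℤ) : ℤ := if 0 ≤ z then ((partsRow N k).getD z.toNat 0 : ℤ) else 0

lemma atMostPartsInt_eq_tableValue (N k : ℕ) {z : ℤ} (h : z < N) :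
    atMostPartsInt k z = tableValue N k z := by
  unfold atMostPartsInt tableValue
  split_ifs with h0
  · rw [atMostParts_eq_getD N (by omega)]
  · rfl

/-- The surplus of partitions with `r` odd parts, all larger than the even parts, over partitions
with `r` odd parts, all smaller than the even parts, when the partitioned number is `r² + 2L`;
the summation index is the number of even parts. -/
def surplus (r L : ℕ) : ℤ :=
  ∑ t ∈ Finset.Icc 1 L,
    (atMostPartsInt (r + t) (L - r - t) - atMostPartsInt (r + t) (L - r * t))

lemma surplus_eq_sum {r L T : ℕ} (hr : 1 ≤ r) (hT : L ≤ T) :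
    surplus r L = ∑ t ∈ Finset.Icc 1 T,
      (atMostPartsInt (r + t) (L - r - t) - atMostPartsInt (r + t) (L - r * t)) := by
  refine Finset.sum_subset (Finset.Icc_subset_Icc_right hT) fun t ht ht' => ?_
  simp only [Finset.mem_Icc, not_and, not_le] at ht ht'
  have h1 : (L : ℤ) < t := by exact_mod_cast ht' ht.1
  have h2 : (1 : ℤ) ≤ r := by exact_mod_cast hr
  rw [atMostPartsInt_of_neg _ (by omega), atMostPartsInt_of_neg _ (by nlinarith), sub_zero]

lemma surplus_term_nonneg {r L t : ℕ} (hr : 2 ≤ r) (ht : 2 ≤ t) :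
    0 ≤ atMostPartsInt (r + t) (L - r - t) - atMostPartsInt (r + t) (L - r * t) := by
  refine sub_nonneg.mpr (atMostPartsInt_mono (by omega) ?_)
  have h1 : (2 : ℤ) ≤ t := by exact_mod_cast ht
  have h2 : (2 : ℤ) ≤ r := by exact_mod_cast hr
  nlinarith

lemma partsTwoTo_le_surplus_term {r L t : ℕ} (hr : 3 ≤ r) (ht : 2 ≤ t) :
    partsTwoTo (r + t) (L - r - t) ≤
      atMostPartsInt (r + t) (L - r - t) - atMostPartsInt (r + t) (L - r * t) := by
  refine sub_le_sub_left (atMostPartsInt_mono (by omega) ?_) _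
  have h1 : (2 : ℤ) ≤ t := by exact_mod_cast ht
  have h2 : (3 : ℤ) ≤ r := by exact_mod_cast hr
  nlinarith

lemma partsTwoTo_eq_sum_largest (k : ℕ) (z : ℤ) :
    partsTwoTo (k + 1) z = (if z = 0 then 1 else 0) +
      ∑ j ∈ Finset.Icc 2 (k + 1), partsTwoTo j (z - j) := by
  induction k with
  | zero => simp [partsTwoTo_one]
  | succ k ih =>
    rw [partsTwoTo_succ, Finset.sum_Icc_succ_top (by omega), ih]
    push_cast
    ring

lemma surplus_ge {r L : ℕ} (hr : 3 ≤ r) : -(if L = r then 1 else 0) ≤ surplus r L := by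
  rw [surplus_eq_sum (T := L + r + 1) (by omega) (by omega),
    ← Finset.add_sum_Ioc_eq_sum_Icc (by omega)]
  have h1 : ∑ t ∈ Finset.Icc 2 (r + 1), partsTwoTo t ((L : ℤ) - r - t) ≤
      ∑ t ∈ Finset.Ioc 1 (L + r + 1),
        (atMostPartsInt (r + t) (L - r - t) - atMostPartsInt (r + t) (L - r * t)) := by
    calc _ ≤ ∑ t ∈ Finset.Icc 2 (r + 1), (atMostPartsInt (r + t) (L - r - t) -
          atMostPartsInt (r + t) (L - r * t)) := by
          refine Finset.sum_le_sum fun t ht => ?_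
          exact (partsTwoTo_mono (by omega) _).trans
            (partsTwoTo_le_surplus_term hr (Finset.mem_Icc.mp ht).1)
      _ ≤ _ := by
          refine Finset.sum_le_sum_of_subset_of_nonneg ?_ fun t ht _ => ?_
          · intro t ht
            simp only [Finset.mem_Icc, Finset.mem_Ioc] at ht ⊢
            omega
          · exact surplus_term_nonneg (by omega) (Finset.mem_Ioc.mp ht).1
  have h2 := partsTwoTo_eq_sum_largest r ((L : ℤ) - r)
  have h3 : atMostPartsInt (r + 1) ((L : ℤ) - r - (1 : ℕ)) -
      atMostPartsInt (r + 1) ((L : ℤ) - r * (1 : ℕ)) = - partsTwoTo (r + 1) ((L : ℤ) - r) := by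
    simp [partsTwoTo]
  have h4 : (if (L : ℤ) - r = 0 then (1 : ℤ) else 0) = if L = r then 1 else 0 := by
    congr 1; simp [sub_eq_zero]
  rw [h3]
  linarith

lemma three_le_partsTwoTo_three : ∀ z : ℤ, 14 ≤ z → 3 ≤ partsTwoTo 3 z := by
  refine int_induction_step 14 3 (by norm_num) ?_ ?_
  · intro z h1 h2
    rw [partsTwoTo, atMostPartsInt_eq_tableValue 20 3 (by push_cast; omega),
      atMostPartsInt_eq_tableValue 20 3 (by push_cast; omega)]
    have : ∀ z ∈ Finset.Ico (14 : ℤ) 17, 3 ≤ tableValue 20 3 z - tableValue 20 3 (z - 1) := by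
      decide +kernel
    exact this z (Finset.mem_Ico.mpr ⟨h1, h2⟩)
  · intro z _ h
    rw [partsTwoTo_succ 2]
    have := partsTwoTo_nonneg (k := 2) (by norm_num) (z + 3)
    norm_num
    linarith

lemma two_le_surplus_two {L : ℕ} (hL : 23 ≤ L) : 2 ≤ surplus 2 L := by
  have h1 : ∑ t ∈ Finset.Icc 1 4,
      (atMostPartsInt (2 + t) (L - (2 : ℕ) - t) - atMostPartsInt (2 + t) (L - (2 : ℕ) * t)) ≤
      surplus 2 L := by
    refine Finset.sum_le_sum_of_subset_of_nonneg (Finset.Icc_subset_Icc_right (by omega)) ?_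
    intro t _ ht
    refine surplus_term_nonneg le_rfl ?_
    simp only [Finset.mem_Icc] at *
    omega
  refine le_trans ?_ h1
  simp only [Finset.sum_Icc_succ_top, Nat.reduceLeDiff, Finset.Icc_self, Finset.sum_singleton,
    Nat.reduceAdd, Nat.cast_ofNat, Nat.cast_one]
  have e1 : partsTwoTo 3 ((L : ℤ) - 2) = atMostPartsInt 3 (L - 2) - atMostPartsInt 3 (L - 3) := by
    rw [partsTwoTo]; ring_nf
  have e2 : partsTwoTo 5 ((L : ℤ) - 5) = atMostPartsInt 5 (L - 5) - atMostPartsInt 5 (L - 6) := by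
    rw [partsTwoTo]; ring_nf
  have e3 : partsTwoTo 6 ((L : ℤ) - 6) = atMostPartsInt 6 (L - 6) - atMostPartsInt 6 (L - 7) := by
    rw [partsTwoTo]; ring_nf
  have e4 : partsTwoTo 3 ((L : ℤ) - 2) = partsTwoTo 2 (L - 2) + partsTwoTo 3 (L - 5) := by
    rw [partsTwoTo_succ 2]; ring_nf
  have h2 := partsTwoTo_two_le_one ((L : ℤ) - 2)
  have h3 := partsTwoTo_mono (show 3 ≤ 5 by norm_num) ((L : ℤ) - 5)
  have h4 := partsTwoTo_mono (show 3 ≤ 6 by norm_num) ((L : ℤ) - 6)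
  have h5 := three_le_partsTwoTo_three ((L : ℤ) - 6) (by omega)
  have h6 := atMostPartsInt_mono (k := 6) (by norm_num) (show (L : ℤ) - 8 ≤ L - 7 by omega)
  ring_nf at *
  linarith

lemma atMostPartsInt_sub_mono {k l : ℕ} (h : k ≤ l) {y z : ℤ} (hyz : y ≤ z) :
    atMostPartsInt k z - atMostPartsInt k y ≤ atMostPartsInt l z - atMostPartsInt l y := by
  induction l, h using Nat.le_induction with
  | base => rfl
  | succ l hl ih =>
    rw [atMostPartsInt_succ l z, atMostPartsInt_succ l y]
    have := atMostPartsInt_mono (k := l + 1) (by omega)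
      (show y - ((l : ℤ) + 1) ≤ z - (l + 1) by omega)
    linarith

lemma partsTwoTo_sub_four_le {l : ℕ} (hl : 4 ≤ l) (z : ℤ) :
    partsTwoTo l (z + 5) - partsTwoTo 4 (z + 5) ≤
      atMostPartsInt l z - atMostPartsInt l (z - (l - 4)) := by
  induction l, hl using Nat.le_induction with
  | base => simp
  | succ l hl ih =>
    have h1 := atMostPartsInt_sub_mono (show l ≤ l + 1 by omega)
      (show z - ((l : ℤ) - 4) ≤ z by omega)
    have h2 : partsTwoTo (l + 1) (z - (l - 4)) = atMostPartsInt (l + 1) (z - (l - 4)) -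
        atMostPartsInt (l + 1) (z - ((l + 1 : ℕ) - 4)) := by
      rw [partsTwoTo]; push_cast; ring_nf
    rw [partsTwoTo_succ, show z + 5 - ((l : ℤ) + 1) = z - (l - 4) by ring]
    linarith

lemma atMostPartsInt_two_shift : ∀ z : ℤ, 0 ≤ z →
    atMostPartsInt 2 (z + 15) + atMostPartsInt 2 (z + 4) ≤
      atMostPartsInt 2 z + atMostPartsInt 2 (z + 9) + atMostPartsInt 2 (z + 10) := by
  refine int_induction_step 0 2 (by norm_num) ?_ ?_
  · intro z h1 h2
    have : ∀ z ∈ Finset.Ico (0 : ℤ) 2, tableValue 20 2 (z + 15) + tableValue 20 2 (z + 4) ≤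
        tableValue 20 2 z + tableValue 20 2 (z + 9) + tableValue 20 2 (z + 10) := by
      decide +kernel
    simpa (disch := push_cast; omega) only [atMostPartsInt_eq_tableValue 20] using
      this z (Finset.mem_Ico.mpr ⟨h1, h2⟩)
  · intro z h1 h2
    have h (y : ℤ) (hy : 0 ≤ y) : atMostPartsInt 2 (y + 2) = 1 + atMostPartsInt 2 y := by
      rw [atMostPartsInt_succ 1, atMostPartsInt_one (by omega)]; norm_num
    rw [show z + 2 + 15 = z + 15 + 2 by ring, show z + 2 + 4 = z + 4 + 2 by ring,
      show z + 2 + 9 = z + 9 + 2 by ring, show z + 2 + 10 = z + 10 + 2 by ring,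
      h _ (by omega), h _ (by omega), h _ (by omega), h _ (by omega), h _ (by omega)]
    linarith

lemma atMostPartsInt_three_shift : ∀ z : ℤ, 5 ≤ z →
    atMostPartsInt 3 (z + 15) + atMostPartsInt 3 (z + 4) ≤
      atMostPartsInt 3 z + atMostPartsInt 3 (z + 9) + atMostPartsInt 3 (z + 10) := by
  refine int_induction_step 5 3 (by norm_num) ?_ ?_
  · intro z h1 h2
    have : ∀ z ∈ Finset.Ico (5 : ℤ) 8, tableValue 25 3 (z + 15) + tableValue 25 3 (z + 4) ≤
        tableValue 25 3 z + tableValue 25 3 (z + 9) + tableValue 25 3 (z + 10) := by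
      decide +kernel
    simpa (disch := push_cast; omega) only [atMostPartsInt_eq_tableValue 25] using
      this z (Finset.mem_Ico.mpr ⟨h1, h2⟩)
  · intro z h1 h2
    have h (y : ℤ) : atMostPartsInt 3 (y + 3) = atMostPartsInt 2 (y + 3) + atMostPartsInt 3 y := by
      rw [atMostPartsInt_succ 2]; norm_num
    have h3 := atMostPartsInt_two_shift (z + 3) (by omega)
    have e15 := h (z + 15)
    have e4 := h (z + 4)
    have e9 := h (z + 9)
    have e10 := h (z + 10)
    have e0 := h z
    ring_nf at *
    linarith

lemma atMostPartsInt_four_shift : ∀ z : ℤ, 12 ≤ z →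
    atMostPartsInt 4 (z + 15) + atMostPartsInt 4 (z + 4) ≤
      atMostPartsInt 4 z + atMostPartsInt 4 (z + 9) + atMostPartsInt 4 (z + 10) := by
  refine int_induction_step 12 4 (by norm_num) ?_ ?_
  · intro z h1 h2
    have : ∀ z ∈ Finset.Ico (12 : ℤ) 16, tableValue 35 4 (z + 15) + tableValue 35 4 (z + 4) ≤
        tableValue 35 4 z + tableValue 35 4 (z + 9) + tableValue 35 4 (z + 10) := by
      decide +kernel
    simpa (disch := push_cast; omega) only [atMostPartsInt_eq_tableValue 35] using
      this z (Finset.mem_Ico.mpr ⟨h1, h2⟩)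
  · intro z h1 h2
    have h (y : ℤ) : atMostPartsInt 4 (y + 4) = atMostPartsInt 3 (y + 4) + atMostPartsInt 4 y := by
      rw [atMostPartsInt_succ 3]; norm_num
    have h3 := atMostPartsInt_three_shift (z + 4) (by omega)
    have e15 := h (z + 15)
    have e4 := h (z + 4)
    have e9 := h (z + 9)
    have e10 := h (z + 10)
    have e0 := h z
    ring_nf at *
    linarith

lemma atMostPartsInt_four_sub_le_five : ∀ z : ℤ, 19 ≤ z →
    atMostPartsInt 4 (z + 15) ≤ atMostPartsInt 5 z + atMostPartsInt 4 (z + 9) := by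
  refine int_induction_step 19 5 (by norm_num) ?_ ?_
  · intro z h1 h2
    have : ∀ z ∈ Finset.Ico (19 : ℤ) 24, tableValue 40 4 (z + 15) ≤
        tableValue 40 5 z + tableValue 40 4 (z + 9) := by
      decide +kernel
    simpa (disch := push_cast; omega) only [atMostPartsInt_eq_tableValue 40] using
      this z (Finset.mem_Ico.mpr ⟨h1, h2⟩)
  · intro z h1 h2
    have e0 : atMostPartsInt 5 (z + 5) = atMostPartsInt 4 (z + 5) + atMostPartsInt 5 z := by
      rw [atMostPartsInt_succ 4]; norm_num
    have h3 := atMostPartsInt_four_shift (z + 5) (by omega)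
    ring_nf at *
    linarith

lemma atMostPartsInt_four_add_two_le_six : ∀ z : ℤ, 26 ≤ z →
    atMostPartsInt 4 (z + 15) + 2 ≤ atMostPartsInt 6 z := by
  refine int_induction_step 26 6 (by norm_num) ?_ ?_
  · intro z h1 h2
    have : ∀ z ∈ Finset.Ico (26 : ℤ) 32, tableValue 50 4 (z + 15) + 2 ≤ tableValue 50 6 z := by
      decide +kernel
    simpa (disch := push_cast; omega) only [atMostPartsInt_eq_tableValue 50] using
      this z (Finset.mem_Ico.mpr ⟨h1, h2⟩)
  · intro z h1 h2
    have e0 : atMostPartsInt 6 (z + 6) = atMostPartsInt 5 (z + 6) + atMostPartsInt 6 z := by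
      rw [atMostPartsInt_succ 5]; norm_num
    have h3 := atMostPartsInt_four_sub_le_five (z + 6) (by omega)
    ring_nf at *
    linarith

lemma sum_surplus_terms_ge (L : ℤ) {N : ℕ} (hN : 6 ≤ N) :
    atMostPartsInt 4 (L - (N - 4)) - atMostPartsInt 4 L +
        (atMostPartsInt 6 (L - 10) - atMostPartsInt 6 (L - 2 * N + 2)) ≤
      ∑ l ∈ Finset.Icc 5 N, ((atMostPartsInt l (L - l) - atMostPartsInt l (L - 3 * l + 9)) -
        partsTwoTo l (L + 5 - l)) := by
  have key (l : ℕ) (hl : 5 ≤ l) : atMostPartsInt l (L - 2 * l + 4) -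
        atMostPartsInt l (L - 3 * l + 9) - partsTwoTo 4 (L + 5 - l) ≤
      (atMostPartsInt l (L - l) - atMostPartsInt l (L - 3 * l + 9)) -
        partsTwoTo l (L + 5 - l) := by
    have := partsTwoTo_sub_four_le (l := l) (by omega) (L - l)
    rw [show L - l - ((l : ℤ) - 4) = L - 2 * l + 4 by ring,
      show L - l + 5 = L + 5 - l by ring] at this
    linarith
  have h4 (z : ℤ) : partsTwoTo 4 z = atMostPartsInt 4 z - atMostPartsInt 4 (z - 1) := rfl
  induction N, hN using Nat.le_induction with
  | base =>
    rw [Finset.sum_Icc_succ_top (by norm_num), Finset.Icc_self, Finset.sum_singleton]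
    have k5 := key 5 (by norm_num)
    have k6 := key 6 (by norm_num)
    have m6 := atMostPartsInt_mono (k := 6) (by norm_num) (show L - 9 ≤ L - 8 by omega)
    rw [h4] at k5 k6
    push_cast at *
    ring_nf at *
    linarith
  | succ N hN ih =>
    rw [Finset.sum_Icc_succ_top (by omega)]
    have k := key (N + 1) (by omega)
    have h6 := atMostPartsInt_sub_mono (show 6 ≤ N + 1 by omega)
      (show L - 2 * (N + 1 : ℕ) + 2 ≤ L - 2 * (N + 1 : ℕ) + 4 by omega)
    have m6 := atMostPartsInt_mono (k := N + 1) (by omega)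
      (show L - 3 * (N + 1 : ℕ) + 9 ≤ L - 2 * (N + 1 : ℕ) + 2 by omega)
    rw [h4] at k
    push_cast at *
    ring_nf at *
    linarith

lemma surplus_one_eq (L : ℕ) :
    surplus 1 (L + 4) = -partsTwoTo 4 (L + 5) - ∑ l ∈ Finset.Icc 5 (L + 5),
      partsTwoTo l (L + 5 - l) := by
  have h1 := partsTwoTo_eq_sum_largest 3 ((L : ℤ) + 5)
  rw [if_neg (by omega)] at h1
  have h2 : surplus 1 (L + 4) = -∑ l ∈ Finset.Icc 2 (L + 5), partsTwoTo l ((L : ℤ) + 5 - l) := by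
    rw [surplus, ← Finset.sum_neg_distrib]
    rw [show Finset.Icc 2 (L + 5) = (Finset.Icc 1 (L + 4)).image (1 + ·) by
      rw [Finset.image_add_left_Icc, add_comm 1 (L + 4)]]
    rw [Finset.sum_image (by simp)]
    refine Finset.sum_congr rfl fun t _ => ?_
    rw [partsTwoTo]
    push_cast
    ring_nf
  have h3 : ∑ l ∈ Finset.Icc 2 (L + 5), partsTwoTo l ((L : ℤ) + 5 - l) =
      ∑ l ∈ Finset.Icc 2 4, partsTwoTo l ((L : ℤ) + 5 - l) +
      ∑ l ∈ Finset.Icc 5 (L + 5), partsTwoTo l ((L : ℤ) + 5 - l) := by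
    rw [← Finset.sum_union]
    · congr 1
      ext x; simp only [Finset.mem_union, Finset.mem_Icc]; omega
    · rw [Finset.disjoint_left]
      intro x; simp only [Finset.mem_Icc]; omega
  rw [h2, h3, h1]
  norm_num
  ring

lemma surplus_three_eq (L : ℕ) :
    surplus 3 L = -partsTwoTo 4 (L - 3) + ∑ l ∈ Finset.Icc 5 (L + 5),
      (atMostPartsInt l (L - l) - atMostPartsInt l (L - 3 * l + 9)) := by
  rw [surplus_eq_sum (T := L + 2) (by norm_num) (by omega),
    ← Finset.add_sum_Ioc_eq_sum_Icc (by omega)]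
  have himage : Finset.Icc 5 (L + 5) = (Finset.Ioc 1 (L + 2)).image (3 + ·) := by
    ext x
    simp only [Finset.mem_image, Finset.mem_Icc, Finset.mem_Ioc]
    exact ⟨fun h => ⟨x - 3, by omega, by omega⟩, fun ⟨y, h, e⟩ => by omega⟩
  rw [himage]
  rw [Finset.sum_image (by simp)]
  congr 1
  · rw [partsTwoTo]; norm_num
  · refine Finset.sum_congr rfl fun t _ => ?_
    push_cast
    ring_nf

lemma two_le_surplus_one_add_three {L : ℕ} (hL : 36 ≤ L) :
    2 ≤ surplus 1 (L + 4) + surplus 3 L := by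
  have h := sum_surplus_terms_ge L (N := L + 5) (by omega)
  rw [atMostPartsInt_of_neg 4 (by push_cast; omega),
    atMostPartsInt_of_neg 6 (z := L - 2 * (L + 5 : ℕ) + 2) (by push_cast; omega),
    Finset.sum_sub_distrib] at h
  rw [surplus_one_eq, surplus_three_eq]
  have h6 := atMostPartsInt_four_add_two_le_six ((L : ℤ) - 10) (by omega)
  rw [show (L : ℤ) - 10 + 15 = L + 5 by ring] at h6
  have e : atMostPartsInt 4 ((L : ℤ) + 5) = atMostPartsInt 4 L + partsTwoTo 4 (L + 1) +
      partsTwoTo 4 (L + 2) + partsTwoTo 4 (L + 3) + partsTwoTo 4 (L + 4) +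
      partsTwoTo 4 (L + 5) := by
    simp only [partsTwoTo]; ring_nf
  have e1 : partsTwoTo 4 ((L : ℤ) + 1) = partsTwoTo 3 (L + 1) + partsTwoTo 4 (L - 3) := by
    rw [partsTwoTo_succ 3]; norm_num; ring_nf
  have p1 := partsTwoTo_nonneg (k := 3) (by norm_num) (L + 1)
  have p2 := partsTwoTo_nonneg (k := 4) (by norm_num) (L + 2)
  have p3 := partsTwoTo_nonneg (k := 4) (by norm_num) (L + 3)
  have p4 := partsTwoTo_nonneg (k := 4) (by norm_num) (L + 4)
  linarith

/-- `surplus r L`, computed from the table of the values below `N`. -/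
def tableSurplus (N r L : ℕ) : ℤ :=
  ∑ t ∈ Finset.Icc 1 L, (tableValue N (r + t) (L - r - t) - tableValue N (r + t) (L - r * t))

lemma surplus_eq_tableSurplus {N L : ℕ} (r : ℕ) (h : L < N) :
    surplus r L = tableSurplus N r L := by
  refine Finset.sum_congr rfl fun t _ => ?_
  rw [atMostPartsInt_eq_tableValue N _ (by omega),
    atMostPartsInt_eq_tableValue N _ (by have : (0 : ℤ) ≤ r * t := by positivity
                                         omega)]

lemma two_le_surplus_one_add_three_add_five {m : ℕ} (h1 : 25 ≤ m) (h2 : m < 40) :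
    2 ≤ surplus 1 m + surplus 3 (m - 4) + surplus 5 (m - 12) := by
  have : ∀ m ∈ Finset.Ico 25 40,
      2 ≤ tableSurplus 40 1 m + tableSurplus 40 3 (m - 4) + tableSurplus 40 5 (m - 12) := by
    decide +kernel
  rw [surplus_eq_tableSurplus (N := 40) 1 h2, surplus_eq_tableSurplus (N := 40) 3 (by omega),
    surplus_eq_tableSurplus (N := 40) 5 (by omega)]
  exact this m (Finset.mem_Ico.mpr ⟨h1, h2⟩)

/-- The weakly increasing lists of `k` natural numbers with sum `m`. -/
def sortedLists (k m : ℕ) : Set (List ℕ) := {l | l.length = k ∧ l.Pairwise (· ≤ ·) ∧ l.sum = m}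

lemma sum_map_add_one (l : List ℕ) : (l.map (· + 1)).sum = l.sum + l.length := by
  induction l with
  | nil => rfl
  | cons a l ih => simp [ih]; ring

lemma sortedLists_succ (k m : ℕ) :
    sortedLists (k + 1) m = List.cons 0 '' sortedLists k m ∪
      if k + 1 ≤ m then List.map (· + 1) '' sortedLists (k + 1) (m - (k + 1)) else ∅ := by
  ext l
  constructor
  · rintro ⟨h1, h2, h3⟩
    match l, h1 with
    | 0 :: l, h1 =>
      exact Or.inl ⟨l, ⟨by simpa using h1, (List.pairwise_cons.mp h2).2, by simpa using h3⟩, rfl⟩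
    | (a + 1) :: l, h1 =>
      right
      have hpos : ∀ x ∈ (a + 1) :: l, 1 ≤ x := by
        intro x hx
        rcases List.mem_cons.mp hx with rfl | hx
        · omega
        · have := (List.pairwise_cons.mp h2).1 x hx
          omega
      have hmap : (((a + 1) :: l).map (· - 1)).map (· + 1) = (a + 1) :: l := by
        rw [List.map_map]
        conv_rhs => rw [← List.map_id ((a + 1) :: l)]
        refine List.map_congr_left fun x hx => ?_
        have := hpos x hx
        simp only [Function.comp_apply, id]
        omega
      have hsum := sum_map_add_one (((a + 1) :: l).map (· - 1))
      rw [hmap, h3, List.length_map, h1] at hsum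
      rw [if_pos (by omega)]
      refine ⟨_, ⟨by rw [List.length_map, h1], ?_, by omega⟩, hmap⟩
      exact h2.map _ fun x y hxy => Nat.sub_le_sub_right hxy 1
  · rintro (⟨l, ⟨h1, h2, h3⟩, rfl⟩ | h)
    · exact ⟨by simp [h1], List.pairwise_cons.mpr ⟨fun _ _ => Nat.zero_le _, h2⟩, by simp [h3]⟩
    · split_ifs at h with hk
      · obtain ⟨l, ⟨h1, h2, h3⟩, rfl⟩ := h
        refine ⟨by simp [h1], h2.map _ fun x y hxy => Nat.add_le_add_right hxy 1, ?_⟩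
        rw [sum_map_add_one]
        omega
      · exact absurd h (Set.notMem_empty l)

lemma encard_sortedLists (k m : ℕ) : (sortedLists k m).encard = atMostParts k m := by
  induction k, m using atMostParts.induct with
  | case1 =>
    have : sortedLists 0 0 = {[]} := by
      ext l
      simp only [sortedLists, Set.mem_ofPred_eq, Set.mem_singleton_iff, List.length_eq_zero_iff]
      exact ⟨fun h => h.1, by rintro rfl; simp⟩
    rw [this]
    simp [atMostParts]
  | case2 m hm =>
    have : sortedLists 0 m = ∅ := by
      ext l
      simp only [sortedLists, Set.mem_ofPred_eq, Set.mem_empty_iff_false, iff_false,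
        List.length_eq_zero_iff]
      rintro ⟨rfl, -, h⟩
      exact hm h.symm
    rw [this]
    simp [atMostParts, hm]
  | case3 k m ih1 ih2 =>
    rw [sortedLists_succ, Set.encard_union_eq, (List.cons_injective).encard_image, ih1,
      atMostParts]
    · push_cast
      congr 1
      split_ifs with h
      · rw [(List.map_injective_iff.mpr (add_left_injective 1)).encard_image, ih2 h]
      · simp
    · rw [Set.disjoint_left]
      rintro _ ⟨l, -, rfl⟩ h
      split_ifs at h with hk
      · obtain ⟨l', -, h⟩ := h
        cases l' <;> simp at h
      · exact h

/-- The list `c + 2 * l₀, c + 2 + 2 * l₁, c + 4 + 2 * l₂, …`. -/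
def stretch : ℕ → List ℕ → List ℕ
  | _, [] => []
  | c, x :: l => (2 * x + c) :: stretch (c + 2) l

lemma length_stretch (c : ℕ) (l : List ℕ) : (stretch c l).length = l.length := by
  induction l generalizing c with
  | nil => rfl
  | cons x l ih => simp [stretch, ih]

lemma sum_stretch (c : ℕ) (l : List ℕ) :
    (stretch c l).sum + l.length = 2 * l.sum + c * l.length + l.length ^ 2 := by
  induction l generalizing c with
  | nil => rfl
  | cons x l ih =>
    have := ih (c + 2)
    simp only [stretch, List.sum_cons, List.length_cons]
    linarith

lemma stretch_injective (c : ℕ) : Function.Injective (stretch c) := by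
  intro l
  induction l generalizing c with
  | nil => intro l' h; cases l' <;> simp_all [stretch]
  | cons x l ih =>
    intro l' h
    cases l' with
    | nil => simp [stretch] at h
    | cons y l' =>
      simp only [stretch, List.cons.injEq] at h
      rw [ih _ h.2, show x = y by omega]

lemma odd_of_mem_stretch {c : ℕ} (hc : Odd c) {l : List ℕ} {y : ℕ} (hy : y ∈ stretch c l) :
    Odd y := by
  induction l generalizing c with
  | nil => simp [stretch] at hy
  | cons x l ih =>
    rcases List.mem_cons.mp hy with rfl | hy
    · exact (even_two_mul x).add_odd hc
    · exact ih (hc.add_even even_two) hy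

lemma le_of_mem_stretch {b c : ℕ} {l : List ℕ} (hb : ∀ x ∈ l, b ≤ x) {y : ℕ}
    (hy : y ∈ stretch c l) : 2 * b + c ≤ y := by
  induction l generalizing c with
  | nil => simp [stretch] at hy
  | cons x l ih =>
    rcases List.mem_cons.mp hy with rfl | hy
    · have := hb x List.mem_cons_self
      omega
    · have := ih (fun x hx => hb x (List.mem_cons_of_mem _ hx)) hy
      omega

lemma pairwise_stretch (c : ℕ) {l : List ℕ} (hl : l.Pairwise (· ≤ ·)) :
    (stretch c l).Pairwise (· < ·) := by
  induction l generalizing c with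
  | nil => exact List.Pairwise.nil
  | cons x l ih =>
    rw [List.pairwise_cons] at hl
    refine List.pairwise_cons.mpr ⟨fun y hy => ?_, ih _ hl.2⟩
    have := le_of_mem_stretch hl.1 hy
    omega

lemma exists_stretch_eq {s : List ℕ} {c : ℕ} (hc : Odd c) (hs : s.Pairwise (· < ·))
    (hodd : ∀ x ∈ s, Odd x) (hle : ∀ x ∈ s, c ≤ x) :
    ∃ l, stretch c l = s ∧ l.Pairwise (· ≤ ·) ∧
      (∀ b, (∀ y ∈ s, b ≤ y) → ∀ x ∈ l, b ≤ 2 * x + c) ∧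
      ∀ e, (∀ y ∈ s, y < e) → ∀ x ∈ l, 2 * x + c + 2 * s.length ≤ e + 1 := by
  induction s generalizing c with
  | nil => exact ⟨[], rfl, List.Pairwise.nil, by simp, by simp⟩
  | cons y s ih =>
    rw [List.pairwise_cons] at hs
    have hy := hodd y List.mem_cons_self
    have hcy := hle y List.mem_cons_self
    have hstep : ∀ z ∈ s, y + 2 ≤ z := fun z hz => by
      have h1 := hs.1 z hz
      have h2 := hodd z (List.mem_cons_of_mem _ hz)
      rw [Nat.odd_iff] at h2 hy
      omega
    obtain ⟨l, h1, h2, h3, h4⟩ := ih (c := c + 2) (hc.add_even even_two) hs.2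
      (fun x hx => hodd x (List.mem_cons_of_mem _ hx)) (fun z hz => by
        have := hstep z hz
        omega)
    have hx : 2 * ((y - c) / 2) + c = y := by
      rw [Nat.odd_iff] at hy hc
      omega
    refine ⟨(y - c) / 2 :: l, by rw [stretch, hx, h1], ?_, ?_, ?_⟩
    · refine List.pairwise_cons.mpr ⟨fun x hxl => ?_, h2⟩
      have := h3 (y + 2) hstep x hxl
      omega
    · intro b hb x hxl
      rcases List.mem_cons.mp hxl with rfl | hxl
      · rw [hx]
        exact hb y List.mem_cons_self
      · have := h3 (y + 2) hstep x hxl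
        have := hb y List.mem_cons_self
        omega
    · intro e he x hxl
      rcases List.mem_cons.mp hxl with rfl | hxl
      · rw [hx]
        match l, h1 with
        | [], h1 =>
          have := he y List.mem_cons_self
          simp only [stretch] at h1
          simp only [← h1, List.length_cons, List.length_nil]
          omega
        | z :: l, h1 =>
          have k1 := h4 e (fun y hy => he y (List.mem_cons_of_mem _ hy)) z List.mem_cons_self
          have k2 := h3 (y + 2) hstep z List.mem_cons_self
          simp only [List.length_cons]
          omega
      · have := h4 e (fun y hy => he y (List.mem_cons_of_mem _ hy)) x hxl
        simp only [List.length_cons]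
        omega

open Classical in
/-- The partitions of `n` satisfying `C` with `r` odd and `t` even parts. -/
noncomputable def partitionsWith (C : Multiset ℕ → Prop) (n r t : ℕ) : Finset n.Partition :=
  Finset.univ.filter fun p => C p.parts ∧
    (p.parts.filter fun x => Odd x).card = r ∧ (p.parts.filter fun x => Even x).card = t

lemma mem_partitionsWith {C : Multiset ℕ → Prop} {n r t : ℕ} {p : n.Partition} :
    p ∈ partitionsWith C n r t ↔ C p.parts ∧
      (p.parts.filter fun x => Odd x).card = r ∧ (p.parts.filter fun x => Even x).card = t := by
  simp [partitionsWith]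

lemma card_parts_le {n : ℕ} (p : n.Partition) : p.parts.card ≤ n := by
  have h := Multiset.card_nsmul_le_sum (s := p.parts) (a := 1) fun x hx => p.parts_pos hx
  rwa [p.parts_sum, smul_eq_mul, mul_one] at h

lemma natCard_eq_sum_partitionsWith (C : Multiset ℕ → Prop) (n : ℕ) :
    Nat.card {p : n.Partition // C p.parts} =
      ∑ r ∈ Finset.range (n + 1), ∑ t ∈ Finset.range (n + 1), (partitionsWith C n r t).card := by
  classical
  rw [Nat.card_eq_fintype_card, Fintype.card_subtype, ← Finset.sum_product',
    Finset.card_eq_sum_card_fiberwise (t := Finset.range (n + 1) ×ˢ Finset.range (n + 1))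
      (f := fun p : n.Partition => ((p.parts.filter fun x => Odd x).card,
        (p.parts.filter fun x => Even x).card))]
  · refine Finset.sum_congr rfl fun rt _ => congrArg Finset.card ?_
    ext p
    simp [mem_partitionsWith, Prod.ext_iff]
  · intro p _
    have h := card_parts_le p
    have h1 := Multiset.card_le_card (Multiset.filter_le (fun x => Odd x) p.parts)
    have h2 := Multiset.card_le_card (Multiset.filter_le (fun x => Even x) p.parts)
    simp only [Finset.coe_product, Finset.coe_range, Set.mem_prod, Set.mem_Iio]
    omega

lemma filter_odd_add_filter_even (M : Multiset ℕ) :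
    M.filter (fun x => Odd x) + M.filter (fun x => Even x) = M := by
  simp_rw [← Nat.not_odd_iff_even]
  exact Multiset.filter_add_not _ _

lemma partitionsWith_zero_odd (n t : ℕ) :
    partitionsWith EvenGtOddDistinct n 0 t = partitionsWith OddDistinctGtEven n 0 t := by
  ext p
  rw [mem_partitionsWith, mem_partitionsWith]
  refine and_congr_left fun ⟨h, _⟩ => ?_
  rw [Multiset.card_eq_zero, Multiset.filter_eq_nil] at h
  exact ⟨fun H => ⟨H.1, fun o ho hodd => absurd hodd (h o ho)⟩,
    fun H => ⟨H.1, fun e _ _ o ho hodd => absurd hodd (h o ho)⟩⟩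

lemma sum_map_two_mul_add (l : List ℕ) (c : ℕ) :
    (l.map (2 * · + c)).sum = 2 * l.sum + c * l.length := by
  induction l with
  | nil => rfl
  | cons a l ih => simp only [List.map_cons, List.sum_cons, List.length_cons, ih]; ring

lemma exists_sortedList_of_evenGtOddDistinct {n r t : ℕ} (hr : 1 ≤ r) {p : n.Partition}
    (hp : p ∈ partitionsWith EvenGtOddDistinct n r t) :
    ∃ s, 2 * s + r ^ 2 + 2 * r * t = n ∧ ∃ l ∈ sortedLists (r + t) s,
      p.parts = ((stretch 1 (l.take r) ++ (l.drop r).map (2 * · + 2 * r) : List ℕ) :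
        Multiset ℕ) := by
  obtain ⟨⟨hnodup, hlt⟩, hcr, hct⟩ := mem_partitionsWith.mp hp
  set os := (p.parts.filter fun x => Odd x).sort (· ≤ ·) with hos
  set es := (p.parts.filter fun x => Even x).sort (· ≤ ·) with hes
  have hos' : (os : Multiset ℕ) = p.parts.filter fun x => Odd x := Multiset.sort_eq ..
  have hes' : (es : Multiset ℕ) = p.parts.filter fun x => Even x := Multiset.sort_eq ..
  have hmos (x : ℕ) : x ∈ os ↔ x ∈ p.parts ∧ Odd x := by
    rw [hos, Multiset.mem_sort, Multiset.mem_filter]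
  have hmes (x : ℕ) : x ∈ es ↔ x ∈ p.parts ∧ Even x := by
    rw [hes, Multiset.mem_sort, Multiset.mem_filter]
  have hlos : os.length = r := by rw [hos, Multiset.length_sort, hcr]
  have hles : es.length = t := by rw [hes, Multiset.length_sort, hct]
  have hsos : os.Pairwise (· < ·) := by
    have h1 : os.Pairwise (· ≤ ·) := Multiset.pairwise_sort _ _
    have h2 : os.Nodup := by rwa [← Multiset.coe_nodup, hos']
    exact (h1.and h2).imp fun h => lt_of_le_of_ne h.1 h.2
  have hses : es.Pairwise (· ≤ ·) := Multiset.pairwise_sort _ _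
  obtain ⟨l, h1, h2, -, h4⟩ := exists_stretch_eq (c := 1) odd_one hsos
    (fun x hx => ((hmos x).mp hx).2) (fun x hx => p.parts_pos ((hmos x).mp hx).1)
  have hll : l.length = r := by rw [← hlos, ← h1, length_stretch]
  have hbound : ∀ e ∈ es, ∀ x ∈ l, 2 * x + 2 * r ≤ e := fun e he x hx => by
    have := h4 e (fun y hy => hlt e ((hmes e).mp he).1 ((hmes e).mp he).2 y
      ((hmos y).mp hy).1 ((hmos y).mp hy).2) x hx
    omega
  have hle : ∀ e ∈ es, 2 * r ≤ e := fun e he => by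
    obtain ⟨x, hx⟩ := List.exists_mem_of_length_pos (l := l) (by omega)
    have := hbound e he x hx
    omega
  have hmap : (es.map fun e => (e - 2 * r) / 2).map (2 * · + 2 * r) = es := by
    rw [List.map_map]
    conv_rhs => rw [← List.map_id es]
    refine List.map_congr_left fun e he => ?_
    have h5 := hle e he
    have h6 := ((hmes e).mp he).2
    rw [Nat.even_iff] at h6
    simp only [Function.comp_apply, id]
    omega
  have hparts : p.parts = ((stretch 1 l ++
      (es.map fun e => (e - 2 * r) / 2).map (2 * · + 2 * r) : List ℕ) : Multiset ℕ) := by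
    rw [hmap, h1, ← Multiset.coe_add, hos', hes', filter_odd_add_filter_even]
  refine ⟨(l ++ es.map fun e => (e - 2 * r) / 2).sum, ?_, l ++ es.map fun e => (e - 2 * r) / 2,
    ⟨by simp [hll, hles], ?_, rfl⟩, ?_⟩
  · have hsum := p.parts_sum
    rw [hparts, Multiset.sum_coe, List.sum_append, sum_map_two_mul_add, List.length_map, hles]
      at hsum
    have := sum_stretch 1 l
    rw [hll] at this
    rw [List.sum_append]
    linarith
  · refine List.pairwise_append.mpr ⟨h2, hses.map _ fun x y hxy => ?_, fun x hx y hy => ?_⟩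
    · exact Nat.div_le_div_right (Nat.sub_le_sub_right hxy _)
    · obtain ⟨e, he, rfl⟩ := List.mem_map.mp hy
      have := hbound e he x hx
      omega
  · rw [← hll, List.take_left, List.drop_left, hll]
    exact hparts

lemma card_evenGtOddDistinct_le {n r t L : ℕ} (hr : 1 ≤ r) (hn : n = r ^ 2 + 2 * L) :
    ((partitionsWith EvenGtOddDistinct n r t).card : ℤ) ≤
      atMostPartsInt (r + t) (L - r * t) := by
  rcases Finset.eq_empty_or_nonempty (partitionsWith EvenGtOddDistinct n r t) with h | ⟨p, hp⟩
  · rw [h, Finset.card_empty]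
    exact atMostPartsInt_nonneg _ _
  obtain ⟨s, hs, -⟩ := exists_sortedList_of_evenGtOddDistinct hr hp
  have hL : (L : ℤ) - r * t = s := by
    zify at hs hn
    linarith
  rw [hL, atMostPartsInt_natCast, Nat.cast_le]
  choose! f hf using fun p hp => exists_sortedList_of_evenGtOddDistinct (n := n) (t := t) (p := p)
    hr hp
  choose! g hg using fun p hp => (hf p hp).2
  have hinj : Set.InjOn g (partitionsWith EvenGtOddDistinct n r t : Set n.Partition) := by
    intro p hp q hq hpq
    refine Nat.Partition.ext ?_
    rw [(hg p hp).2, (hg q hq).2, hpq]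
  have hsub : g '' (partitionsWith EvenGtOddDistinct n r t : Set n.Partition) ⊆
      sortedLists (r + t) s := by
    rintro _ ⟨p, hp, rfl⟩
    have h1 := (hf p hp).1
    rw [show s = f p by omega]
    exact (hg p hp).1
  have := Set.encard_le_encard hsub
  rw [hinj.encard_image, encard_sortedLists, Set.encard_coe_eq_coe_finsetCard] at this
  exact_mod_cast this

lemma evenGtOddDistinct_eq_empty {n r t : ℕ} (hr : 1 ≤ r) (hn : ∀ L, n ≠ r ^ 2 + 2 * L) :
    partitionsWith EvenGtOddDistinct n r t = ∅ := by
  refine Finset.eq_empty_of_forall_notMem fun p hp => ?_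
  obtain ⟨s, hs, -⟩ := exists_sortedList_of_evenGtOddDistinct hr hp
  exact hn (s + r * t) (by rw [← hs]; ring)

/-- Lists in `sortedLists (t + r) s` embed into the partitions of `n` with `r` odd parts larger
than the `t` even parts, if the entry `x` at one of the first `t` positions is sent to the even
part `2 * x + 2` and the other entries are stretched to odd parts, the first one `x` to
`2 * x + c`. -/
lemma atMostParts_le_card_oddDistinctGtEven {n r t s c : ℕ} (hc : Odd c) (hct : t = 0 ∨ 3 ≤ c)
    (hn : n + r = 2 * s + 2 * t + c * r + r ^ 2) :
    atMostParts (t + r) s ≤ (partitionsWith OddDistinctGtEven n r t).card := by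
  classical
  let F (l : List ℕ) : List ℕ := (l.take t).map (2 * · + 2) ++ stretch c (l.drop t)
  have hlt (l : List ℕ) (hl : l ∈ sortedLists (t + r) s) :
      ∀ a ∈ (l.take t).map (2 * · + 2), ∀ b ∈ stretch c (l.drop t), a < b := by
    intro a ha b hb
    obtain ⟨x, hx, rfl⟩ := List.mem_map.mp ha
    have h2 := hl.2.1
    rw [← List.take_append_drop t l, List.pairwise_append] at h2
    have := le_of_mem_stretch (h2.2.2 x hx) hb
    rcases hct with rfl | h3
    · simp at hx
    · omega
  have hev (l : List ℕ) : ∀ a ∈ (l.take t).map (2 * · + 2), Even a := by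
    intro a ha
    obtain ⟨x, hx, rfl⟩ := List.mem_map.mp ha
    exact (even_two_mul x).add even_two
  have hodd (l : List ℕ) : ∀ b ∈ stretch c (l.drop t), Odd b := fun b hb =>
    odd_of_mem_stretch hc hb
  have hF (l : List ℕ) (hl : l ∈ sortedLists (t + r) s) : (F l).Pairwise (· ≤ ·) := by
    have h2 := hl.2.1
    rw [← List.take_append_drop t l, List.pairwise_append] at h2
    exact List.pairwise_append.mpr ⟨h2.1.map _ fun x y hxy => by omega,
      (pairwise_stretch c h2.2.1).imp le_of_lt, fun a ha b hb => (hlt l hl a ha b hb).le⟩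
  have hFo (l : List ℕ) : (F l : Multiset ℕ).filter (fun x => Odd x) = stretch c (l.drop t) := by
    rw [Multiset.filter_coe, List.filter_append, List.filter_eq_nil_iff.mpr, List.nil_append,
      List.filter_eq_self.mpr]
    · simpa using hodd l
    · simpa using hev l
  have hFe (l : List ℕ) : (F l : Multiset ℕ).filter (fun x => Even x) =
      (l.take t).map (2 * · + 2) := by
    rw [Multiset.filter_coe, List.filter_append, List.filter_eq_self.mpr,
      List.filter_eq_nil_iff.mpr, List.append_nil]
    · simpa using hodd l
    · simpa using hev l
  have hlen1 (l : List ℕ) (hl : l ∈ sortedLists (t + r) s) : (l.take t).length = t := by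
    rw [List.length_take, hl.1]; omega
  have hlen2 (l : List ℕ) (hl : l ∈ sortedLists (t + r) s) : (l.drop t).length = r := by
    rw [List.length_drop, hl.1]; omega
  have hsum (l : List ℕ) (hl : l ∈ sortedLists (t + r) s) : (F l).sum = n := by
    have h1 := sum_stretch c (l.drop t)
    have h2 := hl.2.2
    rw [← List.take_append_drop t l, List.sum_append] at h2
    rw [hlen2 l hl] at h1
    rw [List.sum_append, sum_map_two_mul_add, hlen1 l hl]
    linarith
  have hpos (l : List ℕ) : ∀ a ∈ F l, 0 < a := by
    intro a ha
    rcases List.mem_append.mp ha with ha | ha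
    · obtain ⟨x, hx, rfl⟩ := List.mem_map.mp ha
      omega
    · exact (hodd l a ha).pos
  let G (l : List ℕ) : n.Partition :=
    if hl : l ∈ sortedLists (t + r) s then
      ⟨F l, fun {a} ha => hpos l a ha, by rw [Multiset.sum_coe, hsum l hl]⟩
    else Nat.Partition.indiscrete n
  have hG (l : List ℕ) (hl : l ∈ sortedLists (t + r) s) : (G l).parts = F l := by
    simp only [G, dif_pos hl]
  have hinj : Set.InjOn G (sortedLists (t + r) s) := by
    intro l hl l' hl' h
    have h1 : (F l : Multiset ℕ) = F l' := by rw [← hG l hl, ← hG l' hl', h]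
    have h2 : F l = F l' := (Multiset.coe_eq_coe.mp h1).eq_of_pairwise'
      (hF l hl) (hF l' hl')
    obtain ⟨h3, h4⟩ := List.append_inj h2 (by
      rw [List.length_map, List.length_map, hlen1 l hl, hlen1 l' hl'])
    rw [← List.take_append_drop t l, ← List.take_append_drop t l', stretch_injective c h4,
      List.map_injective_iff.mpr (fun x y hxy => by simpa using hxy) h3]
  have hsub : G '' sortedLists (t + r) s ⊆ partitionsWith OddDistinctGtEven n r t := by
    rintro _ ⟨l, hl, rfl⟩
    rw [Finset.mem_coe, mem_partitionsWith, OddDistinctGtEven, hG l hl, hFo, hFe]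
    refine ⟨⟨?_, ?_⟩, by simp [length_stretch, hl.1], by simp [hl.1]⟩
    · rw [Multiset.coe_nodup]
      refine (pairwise_stretch c ?_).imp ne_of_lt
      exact hl.2.1.sublist (List.drop_sublist t l)
    · intro o ho hoo e he hee
      refine hlt l hl e ?_ o ?_
      · rcases List.mem_append.mp he with he | he
        · exact he
        · exact absurd hee (Nat.not_even_iff_odd.mpr (hodd l e he))
      · rcases List.mem_append.mp ho with ho | ho
        · exact absurd (hev l o ho) (Nat.not_even_iff_odd.mpr hoo)
        · exact ho
  have := Set.encard_le_encard hsub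
  rw [hinj.encard_image, encard_sortedLists, Set.encard_coe_eq_coe_finsetCard] at this
  exact_mod_cast this

lemma surplus_le_sum_card_sub {n r L : ℕ} (hr : 1 ≤ r) (hn : n = r ^ 2 + 2 * L) :
    surplus r L ≤ ∑ t ∈ Finset.range (n + 1),
      (((partitionsWith OddDistinctGtEven n r t).card : ℤ) -
        (partitionsWith EvenGtOddDistinct n r t).card) := by
  rw [surplus_eq_sum (T := n) hr (by nlinarith), Finset.range_eq_Ico,
    Finset.sum_eq_sum_Ico_succ_bot (by omega)]
  have h0 : (0 : ℤ) ≤ ((partitionsWith OddDistinctGtEven n r 0).card : ℤ) -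
      (partitionsWith EvenGtOddDistinct n r 0).card := by
    have h1 := card_evenGtOddDistinct_le (t := 0) hr hn
    have h2 := atMostParts_le_card_oddDistinctGtEven (n := n) (r := r) (t := 0) (s := L) odd_one
      (Or.inl rfl) (by rw [hn]; ring)
    rw [Nat.cast_zero, mul_zero, sub_zero, atMostPartsInt_natCast, add_zero] at h1
    rw [zero_add] at h2
    have h3 : (atMostParts r L : ℤ) ≤ (partitionsWith OddDistinctGtEven n r 0).card := by
      exact_mod_cast h2
    linarith
  refine le_trans ?_ (le_add_of_nonneg_left h0)
  change ∑ t ∈ Finset.Icc 1 n, _ ≤ ∑ t ∈ Finset.Icc 1 n, _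
  refine Finset.sum_le_sum fun t _ => sub_le_sub ?_ (card_evenGtOddDistinct_le hr hn)
  rcases lt_or_ge L (r + t) with h | h
  · rw [atMostPartsInt_of_neg _ (by omega)]
    positivity
  · rw [show (L : ℤ) - r - t = ((L - (r + t) : ℕ) : ℤ) by omega, atMostPartsInt_natCast,
      add_comm r t]
    refine Nat.cast_le.mpr (atMostParts_le_card_oddDistinctGtEven (c := 3) (by decide)
      (Or.inr le_rfl) ?_)
    rw [hn]
    obtain ⟨d, rfl⟩ := Nat.exists_eq_add_of_le h
    rw [show r + t + d - (t + r) = d by omega]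
    ring

/-- The difference between the numbers of partitions of `n` with `r` odd parts of the two kinds. -/
noncomputable def oddCountDiff (n r : ℕ) : ℤ :=
  ∑ t ∈ Finset.range (n + 1), (((partitionsWith OddDistinctGtEven n r t).card : ℤ) -
    (partitionsWith EvenGtOddDistinct n r t).card)

lemma peuod_sub_podeu (n : ℕ) :
    (peuod n : ℤ) - podeu n = ∑ r ∈ Finset.range (n + 1), oddCountDiff n r := by
  rw [peuod, podeu, natCard_eq_sum_partitionsWith, natCard_eq_sum_partitionsWith]
  push_cast
  simp only [oddCountDiff, Finset.sum_sub_distrib]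

lemma oddCountDiff_nonneg_of_forall_ne {n r : ℕ} (hn : ∀ L, r = 0 ∨ n ≠ r ^ 2 + 2 * L) :
    0 ≤ oddCountDiff n r := by
  refine Finset.sum_nonneg fun t _ => ?_
  rcases Nat.eq_zero_or_pos r with rfl | hr
  · rw [partitionsWith_zero_odd, sub_self]
  · rw [evenGtOddDistinct_eq_empty hr fun L => (hn L).resolve_left hr.ne']
    simp

lemma oddCountDiff_ge {n r : ℕ} (h : r = 0 ∨ 3 ≤ r ∨ ∀ L, n ≠ r ^ 2 + 2 * L) :
    -(if r = Nat.sqrt (n + 1) - 1 then 1 else 0) ≤ oddCountDiff n r := by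
  have hneg : -(if r = Nat.sqrt (n + 1) - 1 then (1 : ℤ) else 0) ≤ 0 := by
    split_ifs <;> norm_num
  by_cases hn : ∀ L, r = 0 ∨ n ≠ r ^ 2 + 2 * L
  · exact hneg.trans (oddCountDiff_nonneg_of_forall_ne hn)
  · push Not at hn
    obtain ⟨L, h0, hL⟩ := hn
    have h3 : 3 ≤ r := (h.resolve_left h0).resolve_right fun H => H L hL
    refine le_trans ?_ ((surplus_ge h3).trans (surplus_le_sum_card_sub (by omega) hL))
    by_cases hr : L = r
    · have : n + 1 = (r + 1) * (r + 1) := by rw [hL, hr]; ring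
      rw [this, Nat.sqrt_eq, Nat.add_sub_cancel, if_pos rfl, if_pos hr]
    · rw [if_neg hr, neg_zero]
      exact hneg

/-- Apart from at most one case, in which the loss is `1`, the values `r` outside `s`
contribute nonnegatively. -/
lemma sum_oddCountDiff_sub_one_le {n : ℕ} {s : Finset ℕ} (hs : s ⊆ Finset.range (n + 1))
    (h : ∀ r, r ∉ s → r = 0 ∨ 3 ≤ r ∨ ∀ L, n ≠ r ^ 2 + 2 * L) :
    ∑ r ∈ s, oddCountDiff n r - 1 ≤ (peuod n : ℤ) - podeu n := by
  rw [peuod_sub_podeu, ← Finset.sum_sdiff hs]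
  have h1 : -1 ≤ ∑ r ∈ Finset.range (n + 1) \ s, oddCountDiff n r := by
    refine le_trans ?_ (Finset.sum_le_sum fun r hr =>
      oddCountDiff_ge (h r (Finset.mem_sdiff.mp hr).2))
    rw [Finset.sum_neg_distrib, Finset.sum_ite_eq']
    split_ifs <;> norm_num
  linarith

theorem podeu_lt_peuod_of_ge_50 : ∀ n : ℕ, 50 ≤ n → podeu n < peuod n := by
  intro n hn
  suffices h : (1 : ℤ) ≤ (peuod n : ℤ) - podeu n by omega
  have hparity {r : ℕ} (hr : r % 2 ≠ n % 2) (L : ℕ) : n ≠ r ^ 2 + 2 * L := by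
    rintro rfl
    apply hr
    rw [Nat.add_mul_mod_self_left, Nat.pow_mod]
    rcases Nat.mod_two_eq_zero_or_one r with h | h <;> simp [h]
  obtain ⟨m, rfl | rfl⟩ := Nat.even_or_odd' n
  · have h := sum_oddCountDiff_sub_one_le (n := 2 * m) (s := {2})
      (by simp only [Finset.singleton_subset_iff, Finset.mem_range]; omega) fun r hr => by
        rw [Finset.mem_singleton] at hr
        by_cases h1 : r = 1
        · exact Or.inr (Or.inr (hparity (by omega)))
        · omega
    have h2 := surplus_le_sum_card_sub (n := 2 * m) (r := 2) (L := m - 2) (by norm_num) (by omega)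
    have h3 := two_le_surplus_two (L := m - 2) (by omega)
    rw [Finset.sum_singleton, oddCountDiff] at h
    linarith
  · have h1 := surplus_le_sum_card_sub (n := 2 * m + 1) (r := 1) (L := m) le_rfl (by omega)
    have h3 := surplus_le_sum_card_sub (n := 2 * m + 1) (r := 3) (L := m - 4) (by norm_num)
      (by omega)
    have h5 := surplus_le_sum_card_sub (n := 2 * m + 1) (r := 5) (L := m - 12) (by norm_num)
      (by omega)
    have hout (r : ℕ) (hr : r ≠ 1) : r = 0 ∨ 3 ≤ r ∨ ∀ L, 2 * m + 1 ≠ r ^ 2 + 2 * L := by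
      by_cases h2 : r = 2
      · exact Or.inr (Or.inr (hparity (by omega)))
      · omega
    rcases lt_or_ge m 40 with hm | hm
    · have h := sum_oddCountDiff_sub_one_le (n := 2 * m + 1) (s := {1, 3, 5})
        (by intro r; simp only [Finset.mem_insert, Finset.mem_singleton, Finset.mem_range]; omega)
        fun r hr => hout r (by rintro rfl; simp at hr)
      have hs := two_le_surplus_one_add_three_add_five (m := m) (by omega) hm
      rw [Finset.sum_insert (by simp), Finset.sum_insert (by simp), Finset.sum_singleton] at h
      simp only [oddCountDiff] at h
      linarith
    · have h := sum_oddCountDiff_sub_one_le (n := 2 * m + 1) (s := {1, 3})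
        (by intro r; simp only [Finset.mem_insert, Finset.mem_singleton, Finset.mem_range]; omega)
        fun r hr => hout r (by rintro rfl; simp at hr)
      have hs := two_le_surplus_one_add_three (L := m - 4) (by omega)
      rw [show m - 4 + 4 = m by omega] at hs
      rw [Finset.sum_insert (by simp), Finset.sum_singleton] at h
      simp only [oddCountDiff] at h
      linarith
end
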